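/- arXiv:2211.16156 — 6 statements merged into one kernel-verified Lean document; each statement's English description precedes it below -/
import Mathlib

section
/- Let A be a uniformly random n-sided die in the balanced sequences model. For every ε > 0, the probability (over A) that the proportion of n-sided dice B that beat A differs from 1/2 by more than ε tends to 0 as n tends to infinity. -/
open Finset

def dieFinset (n : ℕ) : Finset (Fin n → ℕ) :=
  (Fintype.piFinset fun _ : Fin n => Finset.Icc 1 n).filter
    fun A => ∑ i, A i = n * (n + 1) / 2

def beats {n : ℕ} (A B : Fin n → ℕ) : Prop :=
  ((Finset.univ : Finset (Fin n × Fin n)).filter fun p => B p.2 < A p.1).card >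
    ((Finset.univ : Finset (Fin n × Fin n)).filter fun p => A p.1 < B p.2).card

def ties {n : ℕ} (A B : Fin n → ℕ) : Prop :=
  ((Finset.univ : Finset (Fin n × Fin n)).filter fun p => B p.2 < A p.1).card =
    ((Finset.univ : Finset (Fin n × Fin n)).filter fun p => A p.1 < B p.2).card

instance {n : ℕ} (A B : Fin n → ℕ) : Decidable (beats A B) := by unfold beats; infer_instance
instance {n : ℕ} (A B : Fin n → ℕ) : Decidable (ties A B) := by unfold ties; infer_instance

noncomputable def fA {n : ℕ} (A : Fin n → ℕ) (j : ℕ) : ℝ :=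
  ((Finset.univ.filter fun i => A i < j).card : ℝ) +
    (1 / 2) * ((Finset.univ.filter fun i => A i = j).card : ℝ)

noncomputable def gA {n : ℕ} (A : Fin n → ℕ) (j : ℕ) : ℝ := fA A j - j + 1 / 2

noncomputable def e (x : ℝ) : ℂ := Complex.exp (2 * Real.pi * Complex.I * x)

noncomputable def fhat (n : ℕ) (A : Fin n → ℕ) (α β : ℝ) : ℂ :=
  (n : ℂ)⁻¹ * ∑ j ∈ Finset.Icc 1 n, e (α * gA A j + β * ((j : ℝ) - (n + 1) / 2))

section
open Finset

noncomputable def Yc (n : ℕ) (b : ℕ) : ℝ := (b : ℝ) - ((n : ℝ) + 1) / 2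

noncomputable def cf (n : ℕ) (g : ℕ → ℝ) (s β : ℝ) : ℂ :=
  (n : ℂ)⁻¹ * ∑ b ∈ Icc 1 n, Complex.exp (((s * g b + β * Yc n b : ℝ) : ℂ) * Complex.I)

lemma sum_Yc_eq {n : ℕ} (B : Fin n → ℕ) :
    ∑ i, Yc n (B i) = (((∑ i, B i : ℕ) : ℤ) - ((n * (n + 1) / 2 : ℕ) : ℤ) : ℤ) := by
  have h2 : 2 ∣ n * (n + 1) := (Nat.even_mul_succ_self n).two_dvd
  unfold Yc
  rw [Finset.sum_sub_distrib]
  push_cast [Nat.cast_div h2 (by norm_num : ((2 : ℕ) : ℝ) ≠ 0)]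
  have : (((n * (n + 1) / 2 : ℕ) : ℤ) : ℝ) = (n : ℝ) * (n + 1) / 2 := by
    rw [Int.cast_natCast, Nat.cast_div h2 (by norm_num)]; push_cast; ring
  have h3 : ((((n:ℤ) * (n + 1) / 2 : ℤ)) : ℝ) = (n : ℝ) * (n + 1) / 2 := by
    rw [← this]; push_cast; rfl
  rw [h3]
  simp
  ring

lemma mem_die {n : ℕ} (B : Fin n → ℕ) :
    B ∈ dieFinset n ↔ (B ∈ Fintype.piFinset fun _ : Fin n => Finset.Icc 1 n) ∧
      ∑ i, Yc n (B i) = 0 := by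
  unfold dieFinset
  rw [mem_filter, sum_Yc_eq]
  refine and_congr_right fun _ => ?_
  rw [Int.cast_eq_zero, sub_eq_zero]
  exact_mod_cast Iff.rfl

lemma die_range {n : ℕ} {B : Fin n → ℕ} (h : B ∈ dieFinset n) (i : Fin n) : B i ∈ Icc 1 n := by
  have := ((mem_die B).1 h).1
  rw [Fintype.mem_piFinset] at this
  exact this i

lemma cf_pow (n : ℕ) (g : ℕ → ℝ) (s β : ℝ) :
    (cf n g s β) ^ n = ((n : ℂ) ^ n)⁻¹ * ∑ B ∈ Fintype.piFinset (fun _ : Fin n => Finset.Icc 1 n),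
      Complex.exp (((s * ∑ i, g (B i) : ℝ) : ℂ) * Complex.I) *
        Complex.exp (((β * ∑ i, Yc n (B i) : ℝ) : ℂ) * Complex.I) := by
  unfold cf
  rw [mul_pow, inv_pow]
  congr 1
  have := Finset.prod_univ_sum (fun _ : Fin n => Finset.Icc 1 n)
    (fun _ b => Complex.exp (((s * g b + β * Yc n b : ℝ) : ℂ) * Complex.I))
  rw [Finset.prod_const, Finset.card_univ, Fintype.card_fin] at this
  rw [this]
  refine Finset.sum_congr rfl fun B _ => ?_
  rw [← Complex.exp_sum, ← Complex.exp_add]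
  congr 1
  rw [← add_mul, ← Finset.sum_mul]
  congr 1
  rw [← Complex.ofReal_sum, ← Complex.ofReal_add, Finset.sum_add_distrib, Finset.mul_sum,
    Finset.mul_sum]

lemma int_exp (k : ℤ) : ∫ β in (-Real.pi)..Real.pi,
    Complex.exp (((β * (k : ℝ) : ℝ) : ℂ) * Complex.I) = if k = 0 then ((2 * Real.pi : ℝ) : ℂ) else 0 := by
  split_ifs with h
  · subst h; simp; ring
  · have hc : ((k : ℂ) * Complex.I) ≠ 0 := mul_ne_zero (by exact_mod_cast h) Complex.I_ne_zero
    have := integral_exp_mul_complex (a := -Real.pi) (b := Real.pi) hc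
    have h2 : ∀ β : ℝ, (((β * (k : ℝ) : ℝ) : ℂ) * Complex.I) = ((k : ℂ) * Complex.I) * β := by
      intro β; push_cast; ring
    simp_rw [h2]
    rw [this, div_eq_zero_iff]
    left
    rw [sub_eq_zero, Complex.exp_eq_exp_iff_exists_int]
    exact ⟨k, by push_cast; ring⟩

lemma fourier_die (n : ℕ) (g : ℕ → ℝ) (s : ℝ) :
    ∫ β in (-Real.pi)..Real.pi, (cf n g s β) ^ n =
      ((n : ℂ) ^ n)⁻¹ * (2 * Real.pi : ℝ) *
        ∑ B ∈ dieFinset n, Complex.exp (((s * ∑ i, g (B i) : ℝ) : ℂ) * Complex.I) := by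
  simp_rw [cf_pow n]
  rw [intervalIntegral.integral_const_mul, mul_assoc]
  congr 1
  rw [intervalIntegral.integral_finsetSum]
  swap
  · intro B _
    apply Continuous.intervalIntegrable
    fun_prop
  simp_rw [intervalIntegral.integral_const_mul]
  rw [Finset.mul_sum]
  have : dieFinset n = (Fintype.piFinset fun _ : Fin n => Finset.Icc 1 n).filter
      (fun B => ∑ i, Yc n (B i) = 0) := by
    ext B; rw [mem_die, mem_filter]
  rw [this, Finset.sum_filter]
  refine Finset.sum_congr rfl fun B _ => ?_
  rw [sum_Yc_eq, int_exp]
  simp only [Int.cast_eq_zero]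
  split_ifs
  · ring
  · ring

lemma die_nonempty (n : ℕ) : (dieFinset n).Nonempty := by
  refine ⟨fun i => i.1 + 1, ?_⟩
  unfold dieFinset
  rw [mem_filter, Fintype.mem_piFinset]
  refine ⟨fun i => by simp, ?_⟩
  rw [Fin.sum_univ_eq_sum_range (fun i => i + 1) n, ← Finset.sum_range_succ' (fun i => i) n |>.trans (add_zero _)]
  rw [Finset.sum_range_id, Nat.add_sub_cancel, mul_comm]

lemma die_card_pos (n : ℕ) : (0 : ℝ) < #(dieFinset n) := by
  exact_mod_cast (die_nonempty n).card_pos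

end

section
open Finset

lemma psum1 (N : ℕ) (c : ℝ) : ∑ b ∈ Icc 1 N, ((b : ℝ) - c) = N * (N + 1) / 2 - c * N := by
  induction N with
  | zero => simp
  | succ N ih => rw [Finset.sum_Icc_succ_top (by omega), ih]; push_cast; ring

lemma psum2 (N : ℕ) (c : ℝ) : ∑ b ∈ Icc 1 N, ((b : ℝ) - c) ^ 2 =
    N * (N + 1) * (2 * N + 1) / 6 - 2 * c * (N * (N + 1) / 2) + c ^ 2 * N := by
  induction N with
  | zero => simp
  | succ N ih => rw [Finset.sum_Icc_succ_top (by omega), ih]; push_cast; ring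

lemma psum3 (N : ℕ) (c : ℝ) : ∑ b ∈ Icc 1 N, ((b : ℝ) - c) ^ 3 =
    (N * (N + 1) / 2) ^ 2 - 3 * c * (N * (N + 1) * (2 * N + 1) / 6)
      + 3 * c ^ 2 * (N * (N + 1) / 2) - c ^ 3 * N := by
  induction N with
  | zero => simp
  | succ N ih => rw [Finset.sum_Icc_succ_top (by omega), ih]; push_cast; ring

lemma psum4 (N : ℕ) (c : ℝ) : ∑ b ∈ Icc 1 N, ((b : ℝ) - c) ^ 4 =
    N * (N + 1) * (2 * N + 1) * (3 * N ^ 2 + 3 * N - 1) / 30 - 4 * c * (N * (N + 1) / 2) ^ 2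
      + 6 * c ^ 2 * (N * (N + 1) * (2 * N + 1) / 6) - 4 * c ^ 3 * (N * (N + 1) / 2) + c ^ 4 * N := by
  induction N with
  | zero => simp
  | succ N ih => rw [Finset.sum_Icc_succ_top (by omega), ih]; push_cast; ring

lemma psum6 (N : ℕ) (c : ℝ) : ∑ b ∈ Icc 1 N, ((b : ℝ) - c) ^ 6 =
    N * (N + 1) * (2 * N + 1) * (3 * N ^ 4 + 6 * N ^ 3 - 3 * N + 1) / 42
      - 6 * c * (N ^ 2 * (N + 1) ^ 2 * (2 * N ^ 2 + 2 * N - 1) / 12)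
      + 15 * c ^ 2 * (N * (N + 1) * (2 * N + 1) * (3 * N ^ 2 + 3 * N - 1) / 30)
      - 20 * c ^ 3 * (N * (N + 1) / 2) ^ 2
      + 15 * c ^ 4 * (N * (N + 1) * (2 * N + 1) / 6) - 6 * c ^ 5 * (N * (N + 1) / 2) + c ^ 6 * N := by
  induction N with
  | zero => simp
  | succ N ih => rw [Finset.sum_Icc_succ_top (by omega), ih]; push_cast; ring

lemma ysum1 (n : ℕ) : ∑ b ∈ Icc 1 n, Yc n b = 0 := by
  unfold Yc; rw [psum1]; ring
lemma ysum2 (n : ℕ) : ∑ b ∈ Icc 1 n, Yc n b ^ 2 = n * (n ^ 2 - 1) / 12 := by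
  unfold Yc; rw [psum2]; ring
lemma ysum3 (n : ℕ) : ∑ b ∈ Icc 1 n, Yc n b ^ 3 = 0 := by
  unfold Yc; rw [psum3]; ring
lemma ysum4 (n : ℕ) : ∑ b ∈ Icc 1 n, Yc n b ^ 4 = n * (n ^ 2 - 1) * (3 * n ^ 2 - 7) / 240 := by
  unfold Yc; rw [psum4]; ring
lemma ysum6 (n : ℕ) : ∑ b ∈ Icc 1 n, Yc n b ^ 6 =
    n * (n ^ 2 - 1) * (3 * n ^ 4 - 18 * n ^ 2 + 31) / 1344 := by
  unfold Yc; rw [psum6]; ring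

lemma abs_Yc_le {n b : ℕ} (hb : b ∈ Icc 1 n) : |Yc n b| ≤ (n : ℝ) / 2 := by
  rw [mem_Icc] at hb
  have h1 : (1 : ℝ) ≤ b := by exact_mod_cast hb.1
  have h2 : (b : ℝ) ≤ n := by exact_mod_cast hb.2
  unfold Yc
  rw [abs_le]; constructor <;> linarith

lemma Yc_reflect {n b : ℕ} (hb : b ∈ Icc 1 n) : Yc n (n + 1 - b) = - Yc n b := by
  rw [mem_Icc] at hb
  unfold Yc
  rw [Nat.cast_sub (by omega)]; push_cast; ring

lemma sum_sin (n : ℕ) (β : ℝ) : ∑ b ∈ Icc 1 n, Real.sin (β * Yc n b) = 0 := by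
  have h : ∑ b ∈ Icc 1 n, Real.sin (β * Yc n b) = ∑ b ∈ Icc 1 n, - Real.sin (β * Yc n b) := by
    refine Finset.sum_nbij' (fun b => n + 1 - b) (fun b => n + 1 - b) ?_ ?_ ?_ ?_ ?_
    · intro b hb; rw [mem_Icc] at *; omega
    · intro b hb; rw [mem_Icc] at *; omega
    · intro b hb; rw [mem_Icc] at *; omega
    · intro b hb; rw [mem_Icc] at *; omega
    · intro b hb; rw [Yc_reflect hb]; simp
  rw [Finset.sum_neg_distrib] at h
  linarith

lemma cf_zero_eq (n : ℕ) (g : ℕ → ℝ) (β : ℝ) :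
    cf n g 0 β = (((n : ℝ)⁻¹ * ∑ b ∈ Icc 1 n, Real.cos (β * Yc n b) : ℝ) : ℂ) := by
  unfold cf
  have : ∑ b ∈ Icc 1 n, Complex.exp (((0 * g b + β * Yc n b : ℝ) : ℂ) * Complex.I)
      = ((∑ b ∈ Icc 1 n, Real.cos (β * Yc n b) : ℝ) : ℂ)
        + ((∑ b ∈ Icc 1 n, Real.sin (β * Yc n b) : ℝ) : ℂ) * Complex.I := by
    push_cast
    rw [Finset.sum_mul, ← Finset.sum_add_distrib]
    refine Finset.sum_congr rfl fun b _ => ?_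
    rw [Complex.exp_mul_I]; simp
  rw [this, sum_sin]
  push_cast; simp

lemma cf_zero_small {n : ℕ} (hn : 2 ≤ n) (g : ℕ → ℝ) {β : ℝ} (hβ : |β| * n ≤ Real.pi) :
    ‖cf n g 0 β‖ ^ 2 ≤ 1 - (1 / 80) * ((n : ℝ) ^ 2 * β ^ 2) := by
  have hn' : (2 : ℝ) ≤ n := by exact_mod_cast hn
  have hpi := Real.pi_pos
  have key : ∀ b ∈ Icc 1 n, |β * Yc n b| ≤ Real.pi / 2 := by
    intro b hb
    rw [abs_mul]
    have := mul_le_mul_of_nonneg_left (abs_Yc_le hb) (abs_nonneg β)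
    linarith
  have hD0 : 0 ≤ (n : ℝ)⁻¹ * ∑ b ∈ Icc 1 n, Real.cos (β * Yc n b) := by
    refine mul_nonneg (by positivity) (Finset.sum_nonneg fun b hb => ?_)
    have := abs_le.1 (key b hb)
    exact Real.cos_nonneg_of_neg_pi_div_two_le_of_le (by linarith) (by linarith)
  have hsum : ∑ b ∈ Icc 1 n, Real.cos (β * Yc n b) ≤
      n - 2 / Real.pi ^ 2 * β ^ 2 * (n * (n ^ 2 - 1) / 12) := by
    calc _ ≤ ∑ b ∈ Icc 1 n, (1 - 2 / Real.pi ^ 2 * β ^ 2 * Yc n b ^ 2) := by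
          refine Finset.sum_le_sum fun b hb => ?_
          have := Real.cos_le_one_sub_mul_cos_sq (x := β * Yc n b) (by linarith [key b hb])
          rw [mul_pow] at this; linarith
      _ = _ := by rw [Finset.sum_sub_distrib, ← Finset.mul_sum, ysum2]; simp
  have hD1 : (n : ℝ)⁻¹ * ∑ b ∈ Icc 1 n, Real.cos (β * Yc n b) ≤
      1 - 2 / Real.pi ^ 2 * β ^ 2 * ((n ^ 2 - 1) / 12) := by
    rw [inv_mul_le_iff₀ (by linarith)]
    linarith
  have hp : 1 / 5 ≤ 2 / Real.pi ^ 2 := by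
    rw [div_le_div_iff₀ (by norm_num) (by positivity)]
    nlinarith [Real.pi_lt_d2]
  have hn2 : (n : ℝ) ^ 2 / 16 ≤ ((n : ℝ) ^ 2 - 1) / 12 := by nlinarith
  have h3 : (1 / 5) * β ^ 2 * ((n : ℝ) ^ 2 / 16) ≤ 2 / Real.pi ^ 2 * β ^ 2 * ((n ^ 2 - 1) / 12) := by
    gcongr
  rw [cf_zero_eq, Complex.norm_real, Real.norm_eq_abs, sq_abs]
  set D := (n : ℝ)⁻¹ * ∑ b ∈ Icc 1 n, Real.cos (β * Yc n b)
  have : D ≤ 1 := by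
    have : 0 ≤ (1 / 5) * β ^ 2 * ((n : ℝ) ^ 2 / 16) := by positivity
    linarith
  nlinarith

lemma cf_zero_large {n : ℕ} (hn : 2 ≤ n) (g : ℕ → ℝ) {β : ℝ} (hβ : Real.pi ≤ |β| * n)
    (hβ' : |β| ≤ Real.pi) : ‖cf n g 0 β‖ ^ 2 ≤ 1 - 1 / 80 := by
  have hn' : (2 : ℝ) ≤ n := by exact_mod_cast hn
  have hpi := Real.pi_gt_d2
  have hpi' := Real.pi_lt_d2
  set E : ℕ → ℂ := fun b => Complex.exp (((0 * g b + β * Yc n b : ℝ) : ℂ) * Complex.I) with hE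
  have hstep : ∀ b, E (b + 1) = E b * Complex.exp (Complex.I * β) := by
    intro b
    simp only [hE]
    rw [← Complex.exp_add]
    congr 1
    unfold Yc; push_cast; ring
  have htel : ∀ N : ℕ, (∑ b ∈ Icc 1 N, E b) * (Complex.exp (Complex.I * β) - 1) = E (N + 1) - E 1 := by
    intro N
    induction N with
    | zero => simp
    | succ N ih =>
      rw [Finset.sum_Icc_succ_top (by omega), add_mul, ih, hstep (N + 1)]; ring
  have hEn : ∀ b, ‖E b‖ = 1 := fun b => Complex.norm_exp_ofReal_mul_I _
  have h1 : ‖∑ b ∈ Icc 1 n, E b‖ * ‖Complex.exp (Complex.I * β) - 1‖ ≤ 2 := by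
    rw [← norm_mul, htel]
    refine (norm_sub_le _ _).trans ?_
    rw [hEn, hEn]; norm_num
  rw [Complex.norm_exp_I_mul_ofReal_sub_one, Real.norm_eq_abs, abs_mul, abs_two] at h1
  have hsin : 5 / 4 ≤ n * |Real.sin (β / 2)| := by
    have : |Real.sin (β / 2)| = |Real.sin (|β| / 2)| := by
      rcases abs_cases β with h | h
      · rw [h.1]
      · rw [h.1, neg_div, Real.sin_neg, abs_neg]
    rw [this]
    refine le_trans ?_ (mul_le_mul_of_nonneg_left (le_abs_self _) (by linarith))
    have hx0 : 0 < |β| := by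
      by_contra h
      have : |β| = 0 := le_antisymm (not_lt.1 h) (abs_nonneg _)
      rw [this] at hβ; linarith
    by_cases hx : |β| / 2 ≤ 1
    · have h2 := Real.sin_gt_sub_cube (x := |β| / 2) (by linarith)
      have h3 : 5 / 6 * (|β| / 2) ≤ Real.sin (|β| / 2) := by
        have : (|β| / 2) ^ 3 ≤ |β| / 2 := by
          have h0 : 0 ≤ |β| / 2 := by linarith
          nlinarith [mul_nonneg h0 (by nlinarith : (0:ℝ) ≤ 1 - (|β| / 2) ^ 2)]
        linarith
      have := mul_le_mul_of_nonneg_left h3 (by linarith : (0 : ℝ) ≤ n)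
      linarith
    · have h2 := Real.mul_le_sin (x := |β| / 2) (by linarith) (by linarith)
      have h3 : 0.63 ≤ 2 / Real.pi := by
        rw [le_div_iff₀ Real.pi_pos]; linarith
      have h4 : 0.63 ≤ Real.sin (|β| / 2) := by nlinarith
      nlinarith
  have h2 : ‖cf n g 0 β‖ = (n : ℝ)⁻¹ * ‖∑ b ∈ Icc 1 n, E b‖ := by
    unfold cf; rw [norm_mul, norm_inv]; simp [hE]
  have h3 : ‖cf n g 0 β‖ ≤ 4 / 5 := by
    rw [h2, inv_mul_le_iff₀ (by linarith)]
    nlinarith [norm_nonneg (∑ b ∈ Icc 1 n, E b)]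
  nlinarith [norm_nonneg (cf n g 0 β)]

lemma cf_zero_bound {n : ℕ} (hn : 2 ≤ n) (g : ℕ → ℝ) {β : ℝ} (hβ : |β| ≤ Real.pi) :
    ‖cf n g 0 β‖ ^ 2 ≤ 1 - (1 / 80) * min 1 ((n : ℝ) ^ 2 * β ^ 2) := by
  rcases le_total (|β| * n) Real.pi with h | h
  · have := cf_zero_small hn g h
    have := min_le_right 1 ((n : ℝ) ^ 2 * β ^ 2)
    linarith
  · have := cf_zero_large hn g h hβ
    have := min_le_left 1 ((n : ℝ) ^ 2 * β ^ 2)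
    linarith

/-- for unit vectors, 1 - |mean|² ≤ mean |z - c|² with equality at the mean -/
lemma mean_sq {n : ℕ} (hn : 2 ≤ n) (z : ℕ → ℂ) (hz : ∀ b, ‖z b‖ = 1) (c : ℂ) :
    (n : ℝ)⁻¹ * ∑ b ∈ Icc 1 n, ‖z b - c‖ ^ 2 =
      1 - ‖(n : ℂ)⁻¹ * ∑ b ∈ Icc 1 n, z b‖ ^ 2 + ‖(n : ℂ)⁻¹ * ∑ b ∈ Icc 1 n, z b - c‖ ^ 2 := by
  have hn' : (2 : ℝ) ≤ n := by exact_mod_cast hn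
  have hn0 : (n : ℝ) ≠ 0 := by linarith
  have hexp : ∀ b, ‖z b - c‖ ^ 2 = 1 + ‖c‖ ^ 2 - 2 * ((z b).re * c.re + (z b).im * c.im) := by
    intro b
    have h1 : ‖z b‖ ^ 2 = 1 := by rw [hz]; norm_num
    rw [Complex.sq_norm, Complex.normSq_apply] at *
    rw [Complex.sq_norm, Complex.normSq_apply]
    simp only [Complex.sub_re, Complex.sub_im]
    nlinarith
  simp_rw [hexp]
  rw [Finset.sum_sub_distrib, ← Finset.mul_sum, Finset.sum_add_distrib, Finset.sum_add_distrib, ← Finset.sum_mul,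
    ← Finset.sum_mul, ← Complex.re_sum, ← Complex.im_sum]
  set S := ∑ b ∈ Icc 1 n, z b
  have hc : ((n : ℂ)⁻¹ * S) = (((n : ℝ)⁻¹ : ℝ) : ℂ) * S := by push_cast; rfl
  rw [hc]
  simp only [Complex.sq_norm, Complex.normSq_apply, Complex.sub_re, Complex.sub_im,
    Complex.re_ofReal_mul, Complex.im_ofReal_mul]
  simp only [Finset.sum_const, Nat.card_Icc, Nat.add_sub_cancel, nsmul_eq_mul]
  field_simp
  ring

lemma cf_bound {n : ℕ} (hn : 2 ≤ n) (g : ℕ → ℝ) {s β : ℝ} (hβ : |β| ≤ Real.pi) :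
    ‖cf n g s β‖ ^ 2 ≤ 1 - (1 / 160) * min 1 ((n : ℝ) ^ 2 * β ^ 2)
      + s ^ 2 * ((n : ℝ)⁻¹ * ∑ b ∈ Icc 1 n, g b ^ 2) := by
  have hD := cf_zero_bound hn g hβ
  set z : ℕ → ℂ := fun b => Complex.exp (((s * g b + β * Yc n b : ℝ) : ℂ) * Complex.I) with hz
  set w : ℕ → ℂ := fun b => Complex.exp (((0 * g b + β * Yc n b : ℝ) : ℂ) * Complex.I) with hw
  have hz1 : ∀ b, ‖z b‖ = 1 := fun b => Complex.norm_exp_ofReal_mul_I _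
  have hw1 : ∀ b, ‖w b‖ = 1 := fun b => Complex.norm_exp_ofReal_mul_I _
  have ez : cf n g s β = (n : ℂ)⁻¹ * ∑ b ∈ Icc 1 n, z b := rfl
  have ew : cf n g 0 β = (n : ℂ)⁻¹ * ∑ b ∈ Icc 1 n, w b := rfl
  have hm1 := mean_sq hn z hz1 (cf n g s β)
  have hm2 := mean_sq hn w hw1 (cf n g s β)
  rw [← ez, sub_self, norm_zero] at hm1
  rw [← ew] at hm2
  have hd : ∀ b, ‖w b - z b‖ ≤ |s * g b| := by
    intro b
    have : z b = w b * Complex.exp (Complex.I * ((s * g b : ℝ) : ℂ)) := by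
      simp only [hz, hw]; rw [← Complex.exp_add]; congr 1; push_cast; ring
    have h2 : w b - z b = - (w b * (Complex.exp (Complex.I * ((s * g b : ℝ) : ℂ)) - 1)) := by
      rw [this]; ring
    rw [h2, norm_neg, norm_mul, hw1, one_mul]
    exact Real.norm_exp_I_mul_ofReal_sub_one_le
  have hle : (n : ℝ)⁻¹ * ∑ b ∈ Icc 1 n, ‖w b - cf n g s β‖ ^ 2 ≤
      2 * (s ^ 2 * ((n : ℝ)⁻¹ * ∑ b ∈ Icc 1 n, g b ^ 2)) +
      2 * ((n : ℝ)⁻¹ * ∑ b ∈ Icc 1 n, ‖z b - cf n g s β‖ ^ 2) := by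
    have : 2 * (s ^ 2 * ((n : ℝ)⁻¹ * ∑ b ∈ Icc 1 n, g b ^ 2)) +
      2 * ((n : ℝ)⁻¹ * ∑ b ∈ Icc 1 n, ‖z b - cf n g s β‖ ^ 2) = (n : ℝ)⁻¹ *
        ∑ b ∈ Icc 1 n, (2 * (s * g b) ^ 2 + 2 * ‖z b - cf n g s β‖ ^ 2) := by
      simp_rw [Finset.sum_add_distrib, ← Finset.mul_sum, mul_pow, ← Finset.mul_sum]; ring
    rw [this]
    gcongr with b hb
    have h1 : ‖w b - cf n g s β‖ ≤ |s * g b| + ‖z b - cf n g s β‖ := by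
      have : w b - cf n g s β = (w b - z b) + (z b - cf n g s β) := by ring
      rw [this]
      exact (norm_add_le _ _).trans (add_le_add_left (hd b) _)
    have h2 : ‖w b - cf n g s β‖ ^ 2 ≤ (|s * g b| + ‖z b - cf n g s β‖) ^ 2 := by gcongr
    rw [← sq_abs (s * g b)]
    nlinarith [sq_nonneg (|s * g b| - ‖z b - cf n g s β‖)]
  have := sq_nonneg ‖cf n g 0 β - cf n g s β‖
  nlinarith

end

section
open Finset

lemma pow_close {a b : ℂ} (ha : ‖a‖ ≤ 1) (hb : ‖b‖ ≤ 1) (n : ℕ) :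
    ‖a ^ n - b ^ n‖ ≤ n * ‖a - b‖ := by
  induction n with
  | zero => simp
  | succ n ih =>
    have : a ^ (n + 1) - b ^ (n + 1) = (a ^ n - b ^ n) * a + b ^ n * (a - b) := by ring
    rw [this]
    refine (norm_add_le _ _).trans ?_
    rw [norm_mul, norm_mul, norm_pow]
    have h1 : ‖a ^ n - b ^ n‖ * ‖a‖ ≤ n * ‖a - b‖ :=
      (mul_le_of_le_one_right (norm_nonneg _) ha).trans ih
    have h2 : ‖b‖ ^ n * ‖a - b‖ ≤ ‖a - b‖ :=
      mul_le_of_le_one_left (norm_nonneg _) (pow_le_one₀ (norm_nonneg _) hb)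
    push_cast; linarith

lemma exp_third (x : ℝ) (hx : |x| ≤ 1) :
    ‖Complex.exp ((x : ℂ) * Complex.I) - (1 + (x : ℂ) * Complex.I - (x : ℂ) ^ 2 / 2)‖ ≤ |x| ^ 3 := by
  have hx' : ‖(x : ℂ) * Complex.I‖ = |x| := by simp
  have := Complex.exp_bound (x := (x : ℂ) * Complex.I) (by rw [hx']; exact hx) (n := 3) (by norm_num)
  rw [hx'] at this
  have e1 : ∑ m ∈ range 3, ((x : ℂ) * Complex.I) ^ m / (m.factorial : ℂ) =
      1 + (x : ℂ) * Complex.I - (x : ℂ) ^ 2 / 2 := by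
    simp [Finset.sum_range_succ, mul_pow, Nat.factorial]; ring
  rw [e1] at this
  refine this.trans ?_
  have h3 : (0 : ℝ) ≤ |x| ^ 3 := by positivity
  norm_num [Nat.factorial]
  linarith

lemma cf_norm_le (n : ℕ) (g : ℕ → ℝ) (s β : ℝ) : ‖cf n g s β‖ ≤ 1 := by
  unfold cf
  rw [norm_mul, norm_inv]
  have : ‖∑ b ∈ Icc 1 n, Complex.exp (((s * g b + β * Yc n b : ℝ) : ℂ) * Complex.I)‖ ≤ n := by
    refine (norm_sum_le _ _).trans ?_
    simp_rw [Complex.norm_exp_ofReal_mul_I]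
    simp
  simp only [Complex.norm_natCast]
  rcases Nat.eq_zero_or_pos n with h | h
  · subst h; simp
  · rw [inv_mul_le_iff₀ (by exact_mod_cast h)]; simpa using this

lemma cf_taylor {n : ℕ} (hn : 2 ≤ n) (g : ℕ → ℝ) {s β ρ : ℝ} (h0 : ∑ b ∈ Icc 1 n, g b = 0)
    (hρ1 : ρ ≤ 1) (hρ : ∀ b ∈ Icc 1 n, |s * g b + β * Yc n b| ≤ ρ) {q : ℝ}
    (hq : ∑ b ∈ Icc 1 n, (s * g b + β * Yc n b) ^ 2 = q) :
    ‖cf n g s β - ((1 - q / n / 2 : ℝ) : ℂ)‖ ≤ ρ * q / n := by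
  have hn' : (2 : ℝ) ≤ n := by exact_mod_cast hn
  have hn0 : (n : ℂ) ≠ 0 := by exact_mod_cast (by omega : n ≠ 0)
  set ξ : ℕ → ℝ := fun b => s * g b + β * Yc n b with hξ
  have hs1 : ∑ b ∈ Icc 1 n, ξ b = 0 := by
    simp only [hξ]
    rw [Finset.sum_add_distrib, ← Finset.mul_sum, ← Finset.mul_sum, h0, ysum1]; simp
  have e1 : cf n g s β - ((1 - q / n / 2 : ℝ) : ℂ) = (n : ℂ)⁻¹ * ∑ b ∈ Icc 1 n,
      (Complex.exp ((ξ b : ℂ) * Complex.I) - (1 + (ξ b : ℂ) * Complex.I - (ξ b : ℂ) ^ 2 / 2)) := by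
    have h1 : ∑ b ∈ Icc 1 n, (ξ b : ℂ) = 0 := by exact_mod_cast hs1
    have h2 : ∑ b ∈ Icc 1 n, (ξ b : ℂ) ^ 2 = (q : ℂ) := by exact_mod_cast hq
    rw [Finset.sum_sub_distrib, Finset.sum_sub_distrib, Finset.sum_add_distrib, ← Finset.sum_mul,
      ← Finset.sum_div, h1, h2]
    have e0 : cf n g s β = (n : ℂ)⁻¹ * ∑ b ∈ Icc 1 n, Complex.exp ((ξ b : ℂ) * Complex.I) := rfl
    rw [e0]
    generalize ∑ b ∈ Icc 1 n, Complex.exp ((ξ b : ℂ) * Complex.I) = S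
    simp only [Finset.sum_const, Nat.card_Icc, Nat.add_sub_cancel, nsmul_eq_mul]
    push_cast
    field_simp
    ring
  rw [e1, norm_mul, norm_inv, Complex.norm_natCast, inv_mul_eq_div]
  gcongr
  refine (norm_sum_le _ _).trans ?_
  rw [← hq, Finset.mul_sum]
  refine Finset.sum_le_sum fun b hb => ?_
  refine (exp_third (ξ b) ((hρ b hb).trans hρ1)).trans ?_
  rw [pow_succ', sq_abs]
  exact mul_le_mul_of_nonneg_right (hρ b hb) (sq_nonneg _)

lemma cf_pow_taylor {n : ℕ} (hn : 2 ≤ n) (g : ℕ → ℝ) {s β ρ : ℝ} (h0 : ∑ b ∈ Icc 1 n, g b = 0)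
    (hρ1 : ρ ≤ 1) (hρ : ∀ b ∈ Icc 1 n, |s * g b + β * Yc n b| ≤ ρ) {q : ℝ}
    (hq : ∑ b ∈ Icc 1 n, (s * g b + β * Yc n b) ^ 2 = q) (hqn : q ≤ n) :
    ‖(cf n g s β) ^ n - ((Real.exp (-q / 2) : ℝ) : ℂ)‖ ≤ ρ * q + q ^ 2 / n := by
  have hn' : (2 : ℝ) ≤ n := by exact_mod_cast hn
  have hq0 : 0 ≤ q := by rw [← hq]; exact Finset.sum_nonneg fun _ _ => sq_nonneg _
  have e1 : ((Real.exp (-q / 2) : ℝ) : ℂ) = ((Real.exp (-(q / n / 2)) : ℝ) : ℂ) ^ n := by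
    rw [← Complex.ofReal_pow, ← Real.exp_nat_mul]
    congr 2
    field_simp
  have hx0 : 0 ≤ q / n / 2 := by positivity
  have hx1 : q / n / 2 ≤ 1 := by
    rw [div_div, div_le_one (by positivity)]; linarith
  rw [e1]
  refine (pow_close (cf_norm_le n g s β) ?_ n).trans ?_
  · rw [Complex.norm_real, Real.norm_eq_abs, abs_of_pos (Real.exp_pos _), Real.exp_le_one_iff]
    linarith
  have h1 := cf_taylor hn g h0 hρ1 hρ hq
  have h2 : ‖((1 - q / n / 2 : ℝ) : ℂ) - ((Real.exp (-(q / n / 2)) : ℝ) : ℂ)‖ ≤ (q / n / 2) ^ 2 := by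
    rw [← Complex.ofReal_sub, Complex.norm_real]
    have := Real.norm_exp_sub_one_sub_id_le (x := -(q / n / 2))
      (by rw [Real.norm_eq_abs, abs_neg, abs_of_nonneg hx0]; exact hx1)
    rw [Real.norm_eq_abs, Real.norm_eq_abs, abs_neg, sq_abs] at this
    rw [Real.norm_eq_abs, abs_sub_comm]
    convert this using 2; ring
  have h3 : ‖cf n g s β - ((Real.exp (-(q / n / 2)) : ℝ) : ℂ)‖ ≤ ρ * q / n + (q / n / 2) ^ 2 := by
    have : cf n g s β - ((Real.exp (-(q / n / 2)) : ℝ) : ℂ) =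
      (cf n g s β - ((1 - q / n / 2 : ℝ) : ℂ)) +
      (((1 - q / n / 2 : ℝ) : ℂ) - ((Real.exp (-(q / n / 2)) : ℝ) : ℂ)) := by ring
    rw [this]
    exact (norm_add_le _ _).trans (add_le_add h1 h2)
  refine (mul_le_mul_of_nonneg_left h3 (by linarith : (0 : ℝ) ≤ n)).trans ?_
  have e2 : (n : ℝ) * (ρ * q / n + (q / n / 2) ^ 2) = ρ * q + q ^ 2 / n / 4 := by
    field_simp; ring
  rw [e2]
  have : 0 ≤ q ^ 2 / n := by positivity
  linarith

structure GoodSeq (n : ℕ → ℕ) (g : ℕ → ℕ → ℝ) (η : ℕ → ℝ) (σ : ℝ) : Prop where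
  two_le : ∀ k, 2 ≤ n k
  tend : Filter.Tendsto n Filter.atTop Filter.atTop
  eta : Filter.Tendsto η Filter.atTop (nhds 0)
  s0 : ∀ k, ∑ b ∈ Icc 1 (n k), g k b = 0
  s1 : ∀ k, ∑ b ∈ Icc 1 (n k), g k b * Yc (n k) b = 0
  s2 : ∀ k, ∑ b ∈ Icc 1 (n k), g k b ^ 2 = σ * n k
  bd : ∀ k, ∀ b ∈ Icc 1 (n k), |g k b| ≤ η k * √(n k)

open Filter Topology

lemma cf_pointwise {n : ℕ → ℕ} {g : ℕ → ℕ → ℝ} {η : ℕ → ℝ} {σ : ℝ} (H : GoodSeq n g η σ) (t θ : ℝ) :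
    Tendsto (fun k => (cf (n k) (g k) (t / √(n k)) (θ / (n k * √(n k)))) ^ (n k)) atTop
      (𝓝 ((Real.exp (-(σ * t ^ 2 / 2 + θ ^ 2 / 24)) : ℝ) : ℂ)) := by
  have hN : Tendsto (fun k => (n k : ℝ)) atTop atTop := tendsto_natCast_atTop_atTop.comp H.tend
  have hsq : Tendsto (fun k => √(n k : ℝ)) atTop atTop := Real.tendsto_sqrt_atTop.comp hN
  set ρ : ℕ → ℝ := fun k => |t| * η k + |θ| / √(n k) with hρ
  set q : ℕ → ℝ := fun k => σ * t ^ 2 + θ ^ 2 / 12 * (1 - ((n k : ℝ)⁻¹) ^ 2) with hq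
  have hinv : Tendsto (fun k => (n k : ℝ)⁻¹) atTop (𝓝 0) := tendsto_inv_atTop_zero.comp hN
  have hρl : Tendsto ρ atTop (𝓝 0) := by
    have h1 : Tendsto (fun k => |t| * η k) atTop (𝓝 (|t| * 0)) := H.eta.const_mul _
    have h2 : Tendsto (fun k => |θ| / √(n k : ℝ)) atTop (𝓝 0) := hsq.const_div_atTop _
    simpa using h1.add h2
  have hql : Tendsto q atTop (𝓝 (σ * t ^ 2 + θ ^ 2 / 12)) := by
    have : Tendsto q atTop (𝓝 (σ * t ^ 2 + θ ^ 2 / 12 * (1 - 0 ^ 2))) :=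
      ((((hinv.pow 2).const_sub 1).const_mul _).const_add _)
    simpa using this
  have hlim : Tendsto (fun k => ((Real.exp (- q k / 2) : ℝ) : ℂ)) atTop
      (𝓝 ((Real.exp (-(σ * t ^ 2 / 2 + θ ^ 2 / 24)) : ℝ) : ℂ)) := by
    refine (Complex.continuous_ofReal.tendsto _).comp ((Real.continuous_exp.tendsto _).comp ?_)
    have := (hql.neg).div_const 2
    convert this using 2; ring
  have herr : Tendsto (fun k => ρ k * q k + q k ^ 2 / n k) atTop (𝓝 0) := by
    have h1 := hρl.mul hql
    have h2 := (hql.pow 2).mul hinv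
    simpa [div_eq_mul_inv] using h1.add h2
  have hev1 : ∀ᶠ k in atTop, ρ k ≤ 1 := hρl.eventually_le_const (by norm_num)
  have hev2 : ∀ᶠ k in atTop, q k ≤ n k := by
    filter_upwards [hql.eventually_le_const (lt_add_one _), hN.eventually_ge_atTop
      (σ * t ^ 2 + θ ^ 2 / 12 + 1)] with k h1 h2
    linarith
  have hdiff : Tendsto (fun k => (cf (n k) (g k) (t / √(n k)) (θ / (n k * √(n k)))) ^ (n k)
      - ((Real.exp (- q k / 2) : ℝ) : ℂ)) atTop (𝓝 0) := by
    rw [tendsto_zero_iff_norm_tendsto_zero]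
    refine squeeze_zero' (Eventually.of_forall fun _ => norm_nonneg _) ?_ herr
    filter_upwards [hev1, hev2] with k h1 h2
    have hn' : (2 : ℝ) ≤ n k := by exact_mod_cast H.two_le k
    have hs0 : 0 < √(n k : ℝ) := Real.sqrt_pos.2 (by linarith)
    have hss : √(n k : ℝ) ^ 2 = n k := Real.sq_sqrt (by linarith)
    refine cf_pow_taylor (H.two_le k) (g k) (H.s0 k) h1 ?_ ?_ h2
    · intro b hb
      refine (abs_add_le _ _).trans ?_
      simp only [hρ]
      have a1 : |t / √(n k) * g k b| ≤ |t| * η k := by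
        rw [abs_mul, abs_div, abs_of_pos hs0, div_mul_eq_mul_div, div_le_iff₀ hs0, mul_assoc]
        exact mul_le_mul_of_nonneg_left (H.bd k b hb) (abs_nonneg _)
      have a2 : |θ / (n k * √(n k)) * Yc (n k) b| ≤ |θ| / √(n k) := by
        rw [abs_mul, abs_div, abs_of_pos (by positivity : (0:ℝ) < n k * √(n k)), div_mul_eq_mul_div,
          div_le_div_iff₀ (by positivity) hs0]
        have := abs_Yc_le hb
        have h3 : |Yc (n k) b| ≤ n k := by linarith
        calc |θ| * |Yc (n k) b| * √(n k) ≤ |θ| * n k * √(n k) := by gcongr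
          _ = _ := by ring
      linarith
    · have : ∀ b, (t / √(n k) * g k b + θ / (n k * √(n k)) * Yc (n k) b) ^ 2 =
          t ^ 2 / n k * g k b ^ 2 + 2 * t * θ / (n k) ^ 2 * (g k b * Yc (n k) b)
            + θ ^ 2 / (n k) ^ 3 * Yc (n k) b ^ 2 := by
        intro b
        have : t / √(n k) * g k b + θ / (n k * √(n k)) * Yc (n k) b =
          (t * g k b + θ / n k * Yc (n k) b) / √(n k) := by field_simp
        rw [this, div_pow, hss]
        field_simp
        ring
      simp_rw [this]
      rw [Finset.sum_add_distrib, Finset.sum_add_distrib, ← Finset.mul_sum, ← Finset.mul_sum,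
        ← Finset.mul_sum, H.s2, H.s1, ysum2]
      simp only [hq]
      field_simp
      ring
  have := hdiff.add hlim
  simpa using this

lemma exp_dom {n : ℕ} (hn : 2 ≤ n) {θ : ℝ} (hθ : |θ| ≤ Real.pi * (n * √n)) :
    Real.exp (- (min (n : ℝ) (θ ^ 2)) / 320) ≤ 66 * 320 ^ 3 * (1 + θ ^ 2)⁻¹ := by
  have hn' : (2 : ℝ) ≤ n := by exact_mod_cast hn
  have hpos : 0 < 1 + θ ^ 2 := by positivity
  rw [← div_eq_mul_inv, le_div_iff₀ hpos, neg_div, Real.exp_neg, inv_mul_le_iff₀ (Real.exp_pos _)]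
  rcases le_total (n : ℝ) (θ ^ 2) with h | h
  · rw [min_eq_left h]
    have h1 := Real.pow_div_factorial_le_exp (x := (n : ℝ) / 320) (by positivity) 3
    have h2 : θ ^ 2 ≤ 10 * (n : ℝ) ^ 3 := by
      have a : θ ^ 2 ≤ (Real.pi * (n * √n)) ^ 2 := by rw [← sq_abs θ]; gcongr
      have b : (Real.pi * (n * √n)) ^ 2 = Real.pi ^ 2 * (n : ℝ) ^ 3 := by
        rw [mul_pow, mul_pow, Real.sq_sqrt (by linarith)]; ring
      have c : Real.pi ^ 2 ≤ 10 := by nlinarith [Real.pi_lt_d2, Real.pi_pos]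
      rw [b] at a
      exact a.trans (by gcongr)
    have h3 : (1 : ℝ) ≤ (n : ℝ) ^ 3 := one_le_pow₀ (by linarith)
    norm_num [Nat.factorial] at h1
    rw [div_pow] at h1
    norm_num at h1 ⊢
    nlinarith
  · rw [min_eq_right h]
    have h1 := Real.add_one_le_exp (θ ^ 2 / 320)
    nlinarith [sq_nonneg θ]

lemma cf_dom {n : ℕ} (hn : 2 ≤ n) {g : ℕ → ℝ} {σ : ℝ}
    (h2 : ∑ b ∈ Icc 1 n, g b ^ 2 = σ * n) (t : ℝ) {θ : ℝ} (hθ : |θ| ≤ Real.pi * (n * √n)) :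
    ‖(cf n g (t / √n) (θ / (n * √n))) ^ n‖ ≤
      Real.exp (σ * t ^ 2 / 2) * (66 * 320 ^ 3) * (1 + θ ^ 2)⁻¹ := by
  have hn' : (2 : ℝ) ≤ n := by exact_mod_cast hn
  have hs0 : 0 < √(n : ℝ) := Real.sqrt_pos.2 (by linarith)
  have hss : √(n : ℝ) ^ 2 = n := Real.sq_sqrt (by linarith)
  have hr : (0 : ℝ) < n * √n := by positivity
  have hb := cf_bound hn g (s := t / √n) (β := θ / (n * √n))
    (by rw [abs_div, abs_of_pos hr, div_le_iff₀ hr]; exact hθ)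
  rw [h2, div_pow t, hss, div_pow, mul_pow, hss] at hb
  have e1 : (n : ℝ) ^ 2 * (θ ^ 2 / (n ^ 2 * n)) = θ ^ 2 / n := by field_simp
  have e2 : t ^ 2 / n * ((n : ℝ)⁻¹ * (σ * n)) = σ * t ^ 2 / n := by field_simp
  have e3 : min 1 (θ ^ 2 / n) = min (n : ℝ) (θ ^ 2) / n := by
    rw [← min_div_div_right (by linarith : (0 : ℝ) ≤ n), div_self (by positivity)]
  rw [e1, e2, e3] at hb
  set m := min (n : ℝ) (θ ^ 2) with hm
  have h3 : ‖cf n g (t / √n) (θ / (n * √n))‖ ^ 2 ≤ Real.exp ((σ * t ^ 2 - m / 160) / n) := by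
    refine hb.trans ?_
    have := Real.add_one_le_exp ((σ * t ^ 2 - m / 160) / n)
    refine le_trans (le_of_eq ?_) this
    ring
  have h4 : ‖(cf n g (t / √n) (θ / (n * √n))) ^ n‖ ^ 2 ≤ Real.exp (σ * t ^ 2 / 2 - m / 320) ^ 2 := by
    rw [norm_pow, ← pow_mul, mul_comm n 2, pow_mul]
    refine (pow_le_pow_left₀ (by positivity) h3 n).trans (le_of_eq ?_)
    rw [← Real.exp_nat_mul, ← Real.exp_nat_mul]
    congr 1
    push_cast
    field_simp
    ring
  have h5 := (le_abs_self _).trans (abs_le_of_sq_le_sq h4 (Real.exp_pos _).le)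
  refine h5.trans ?_
  have := exp_dom hn hθ
  rw [← hm] at this
  have e4 : Real.exp (σ * t ^ 2 / 2 - m / 320) = Real.exp (σ * t ^ 2 / 2) * Real.exp (- m / 320) := by
    rw [← Real.exp_add]; congr 1; ring
  rw [e4, mul_assoc]
  exact mul_le_mul_of_nonneg_left this (Real.exp_pos _).le

end

section
open Finset
open Filter Topology MeasureTheory

lemma cf_cont (n : ℕ) (g : ℕ → ℝ) (s : ℝ) : Continuous (fun β => cf n g s β) := by
  unfold cf; fun_prop

lemma Z_lim {n : ℕ → ℕ} {g : ℕ → ℕ → ℝ} {η : ℕ → ℝ} {σ : ℝ} (H : GoodSeq n g η σ) (t : ℝ) :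
    Tendsto (fun k => ((n k * √(n k) : ℝ) : ℂ) *
      ∫ β in (-Real.pi)..Real.pi, (cf (n k) (g k) (t / √(n k)) β) ^ (n k)) atTop
      (𝓝 ((Real.exp (-(σ * t ^ 2 / 2)) * √(24 * Real.pi) : ℝ) : ℂ)) := by
  have e1 : ∀ k, ((n k * √(n k) : ℝ) : ℂ) *
      ∫ β in (-Real.pi)..Real.pi, (cf (n k) (g k) (t / √(n k)) β) ^ (n k) =
      ∫ θ, (Set.Ioc (-(Real.pi * (n k * √(n k)))) (Real.pi * (n k * √(n k)))).indicator
        (fun θ => (cf (n k) (g k) (t / √(n k)) (θ / (n k * √(n k)))) ^ (n k)) θ := by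
    intro k
    have hn' : (2 : ℝ) ≤ n k := by exact_mod_cast H.two_le k
    have hr : (0 : ℝ) < n k * √(n k) := by positivity
    have hpi := Real.pi_pos
    rw [integral_indicator measurableSet_Ioc, ← intervalIntegral.integral_of_le (by nlinarith)]
    have := intervalIntegral.integral_comp_div
      (a := -(Real.pi * (n k * √(n k)))) (b := Real.pi * (n k * √(n k)))
      (fun β => (cf (n k) (g k) (t / √(n k)) β) ^ (n k)) hr.ne'
    rw [this, neg_div, mul_div_assoc, div_self hr.ne', Complex.real_smul, mul_one]
  simp_rw [e1]
  have e2 : ((Real.exp (-(σ * t ^ 2 / 2)) * √(24 * Real.pi) : ℝ) : ℂ) =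
      ∫ θ : ℝ, ((Real.exp (-(σ * t ^ 2 / 2 + θ ^ 2 / 24)) : ℝ) : ℂ) := by
    rw [integral_complex_ofReal]
    congr 1
    have : ∀ θ : ℝ, Real.exp (-(σ * t ^ 2 / 2 + θ ^ 2 / 24)) =
        Real.exp (-(σ * t ^ 2 / 2)) * Real.exp (-(1 / 24) * θ ^ 2) := by
      intro θ; rw [← Real.exp_add]; congr 1; ring
    simp_rw [this]
    rw [integral_const_mul, integral_gaussian]
    congr 2; ring
  rw [e2]
  refine tendsto_integral_of_dominated_convergence
    (fun θ => Real.exp (σ * t ^ 2 / 2) * (66 * 320 ^ 3) * (1 + θ ^ 2)⁻¹) ?_ ?_ ?_ ?_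
  · intro k
    refine AEStronglyMeasurable.indicator ?_ measurableSet_Ioc
    apply Continuous.aestronglyMeasurable
    exact ((cf_cont _ _ _).comp (continuous_id.div_const _)).pow _
  · exact integrable_inv_one_add_sq.const_mul _
  · intro k
    refine Eventually.of_forall fun θ => ?_
    by_cases h : θ ∈ Set.Ioc (-(Real.pi * (n k * √(n k)))) (Real.pi * (n k * √(n k)))
    · rw [Set.indicator_of_mem h]
      exact cf_dom (H.two_le k) (H.s2 k) t (abs_le.2 ⟨h.1.le, h.2⟩)
    · rw [Set.indicator_of_notMem h]
      simp only [norm_zero]; positivity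
  · refine Eventually.of_forall fun θ => ?_
    refine (cf_pointwise H t θ).congr' ?_
    have hN : Tendsto (fun k => (n k : ℝ)) atTop atTop := tendsto_natCast_atTop_atTop.comp H.tend
    filter_upwards [hN.eventually_gt_atTop |θ|] with k hk
    rw [Set.indicator_of_mem]
    have hn' : (2 : ℝ) ≤ n k := by exact_mod_cast H.two_le k
    have h1 : (1 : ℝ) ≤ √(n k) := by rw [Real.one_le_sqrt]; linarith
    have h2 : |θ| < Real.pi * (n k * √(n k)) := by
      have : (n k : ℝ) ≤ n k * √(n k) := by nlinarith
      nlinarith [Real.pi_gt_three]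
    exact ⟨(abs_lt.1 h2).1, (abs_lt.1 h2).2.le⟩

lemma avg_lim {n : ℕ → ℕ} {g : ℕ → ℕ → ℝ} {η : ℕ → ℝ} {σ : ℝ} (H : GoodSeq n g η σ) (t : ℝ) :
    Tendsto (fun k => (#(dieFinset (n k)) : ℂ)⁻¹ * ∑ B ∈ dieFinset (n k),
      Complex.exp (((t / √(n k) * ∑ i, g k (B i) : ℝ) : ℂ) * Complex.I)) atTop
      (𝓝 ((Real.exp (-(σ * t ^ 2 / 2)) : ℝ) : ℂ)) := by
  have h1 := Z_lim H t
  have h0 := Z_lim H 0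
  have hG : √(24 * Real.pi) ≠ 0 := by positivity
  have h := h1.div h0 (by
    simp only [ne_eq, Complex.ofReal_eq_zero]; positivity)
  have e1 : ((Real.exp (-(σ * t ^ 2 / 2)) * √(24 * Real.pi) : ℝ) : ℂ) /
     ((Real.exp (-(σ * 0 ^ 2 / 2)) * √(24 * Real.pi) : ℝ) : ℂ) = ((Real.exp (-(σ * t ^ 2 / 2)) : ℝ) : ℂ) := by
    rw [← Complex.ofReal_div]
    congr 1
    rw [mul_div_mul_right _ _ hG]; simp
  rw [e1] at h
  refine h.congr fun k => ?_
  simp only [Pi.div_apply]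
  rw [fourier_die, fourier_die]
  have hn' : (2 : ℝ) ≤ n k := by exact_mod_cast H.two_le k
  have hc1 : ((n k * √(n k) : ℝ) : ℂ) ≠ 0 := by
    simp only [ne_eq, Complex.ofReal_eq_zero]; positivity
  have hc2 : ((n k : ℂ) ^ (n k))⁻¹ ≠ 0 := by
    have : (n k : ℂ) ≠ 0 := by exact_mod_cast (by have := H.two_le k; omega : n k ≠ 0)
    positivity
  have hc3 : ((2 * Real.pi : ℝ) : ℂ) ≠ 0 := by
    simp only [ne_eq, Complex.ofReal_eq_zero]; positivity
  have hc4 : (#(dieFinset (n k)) : ℂ) ≠ 0 := by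
    exact_mod_cast (die_nonempty (n k)).card_pos.ne'
  have e2 : ∑ B ∈ dieFinset (n k), Complex.exp (((0 / √(n k) * ∑ i, g k (B i) : ℝ) : ℂ) * Complex.I)
      = (#(dieFinset (n k)) : ℂ) := by simp
  rw [e2]
  set c1 := ((n k * √(n k) : ℝ) : ℂ)
  set c2 := ((n k : ℂ) ^ (n k))⁻¹
  set c3 := ((2 * Real.pi : ℝ) : ℂ)
  generalize ∑ B ∈ dieFinset (n k),
    Complex.exp (((t / √(n k) * ∑ i, g k (B i) : ℝ) : ℂ) * Complex.I) = S
  field_simp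

lemma card_lim : Tendsto (fun n : ℕ => (n * √n : ℝ) * (((n : ℝ) ^ n)⁻¹ * (2 * Real.pi) * #(dieFinset n)))
    atTop (𝓝 (√(24 * Real.pi))) := by
  have H : GoodSeq (fun k => k + 2) (fun _ _ => 0) (fun _ => 0) 0 := by
    refine ⟨fun k => by omega, tendsto_add_atTop_nat 2, tendsto_const_nhds, ?_, ?_, ?_, ?_⟩ <;> simp
  have h := Z_lim H 0
  rw [← tendsto_add_atTop_iff_nat 2]
  have h2 := (Complex.continuous_re.tendsto _).comp h
  simp only [Complex.ofReal_re] at h2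
  have e : Real.exp (-(0 * 0 ^ 2 / 2)) * √(24 * Real.pi) = √(24 * Real.pi) := by simp
  rw [e] at h2
  refine h2.congr fun k => ?_
  simp only [Function.comp_apply]
  rw [fourier_die]
  simp only [zero_div, zero_mul, Complex.ofReal_zero, Complex.exp_zero, Finset.sum_const, nsmul_eq_mul,
    mul_one]
  rw [← Complex.ofReal_re (((k+2:ℕ) * √(k+2:ℕ) : ℝ) * ((((k+2:ℕ) : ℝ) ^ (k+2))⁻¹ * (2 * Real.pi) * #(dieFinset (k+2))))]
  congr 1
  push_cast
  ring

section emp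
open ENNReal

noncomputable def emp {α : Type*} (S : Finset α) (X : α → ℝ) : Measure ℝ :=
  ((#S : ℝ≥0∞)⁻¹) • ∑ a ∈ S, Measure.dirac (X a)

lemma emp_apply {α : Type*} (S : Finset α) (X : α → ℝ) {E : Set ℝ} (hE : MeasurableSet E)
    [DecidablePred fun a => X a ∈ E] :
    emp S X E = (#S : ℝ≥0∞)⁻¹ * #(S.filter fun a => X a ∈ E) := by
  unfold emp
  rw [Measure.smul_apply, Measure.finsetSum_apply, smul_eq_mul]
  congr 1
  simp_rw [Measure.dirac_apply' _ hE, Set.indicator_apply]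
  simp

lemma emp_prob {α : Type*} (S : Finset α) (hS : S.Nonempty) (X : α → ℝ) :
    IsProbabilityMeasure (emp S X) := by
  classical
  refine ⟨?_⟩
  rw [emp_apply S X MeasurableSet.univ]
  simp only [Set.mem_univ, Finset.filter_true]
  apply ENNReal.inv_mul_cancel
  · exact_mod_cast hS.card_pos.ne'
  · simp

lemma emp_charFun {α : Type*} (S : Finset α) (X : α → ℝ) (t : ℝ) :
    charFun (emp S X) t = (#S : ℂ)⁻¹ * ∑ a ∈ S, Complex.exp (((t * X a : ℝ) : ℂ) * Complex.I) := by
  rw [charFun_apply_real]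
  unfold emp
  rw [integral_smul_measure, integral_finsetSum_measure]
  · simp [Complex.real_smul]
  · intro i _
    exact integrable_dirac (by simp [enorm_lt_top])

end emp

open ProbabilityTheory in
theorem die_clt {n : ℕ → ℕ} {g : ℕ → ℕ → ℝ} {η : ℕ → ℝ} (H : GoodSeq n g η 1) {E : Set ℝ}
    [DecidablePred (· ∈ E)]
    (hE : MeasurableSet E) (hE' : volume (frontier E) = 0) :
    Tendsto (fun k => (#((dieFinset (n k)).filter fun B => (∑ i, g k (B i)) / √(n k) ∈ E) : ℝ) /
      #(dieFinset (n k))) atTop (𝓝 ((gaussianReal 0 1).real E)) := by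
  set μ : ℕ → ProbabilityMeasure ℝ := fun k =>
    ⟨emp (dieFinset (n k)) (fun B => (∑ i, g k (B i)) / √(n k)), emp_prob _ (die_nonempty _) _⟩ with hμ
  have hlim : Tendsto μ atTop (𝓝 (⟨gaussianReal 0 1, inferInstance⟩ : ProbabilityMeasure ℝ)) := by
    refine ProbabilityMeasure.tendsto_of_tendsto_charFun fun t => ?_
    simp only [hμ, ProbabilityMeasure.coe_mk, emp_charFun, charFun_gaussianReal]
    have := avg_lim H t
    convert this using 2 with k
    · congr 1
      refine Finset.sum_congr rfl fun B _ => ?_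
      congr 3; ring
    · push_cast; simp
  have h2 := ProbabilityMeasure.tendsto_measure_of_null_frontier_of_tendsto' hlim (E := E)
    (gaussianReal_absolutelyContinuous 0 one_ne_zero hE')
  have h3 := (ENNReal.tendsto_toReal (measure_ne_top (gaussianReal 0 1) E)).comp h2
  refine h3.congr fun k => ?_
  simp only [hμ, Function.comp_apply, ProbabilityMeasure.coe_mk]
  rw [emp_apply _ _ hE]
  simp [div_eq_inv_mul]

end

section
open Finset
open Filter Topology MeasureTheory

open ProbabilityTheory in
lemma gauss_half : (gaussianReal 0 1).real (Set.Ioi 0) = 1 / 2 := by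
  have : NullSingletonClass (gaussianReal 0 1) := nullSingletonClass_gaussianReal one_ne_zero
  have h1 : (gaussianReal 0 1).real (Set.Iio 0) = (gaussianReal 0 1).real (Set.Ioi 0) := by
    have := gaussianReal_map_neg (μ := 0) (v := 1)
    rw [neg_zero] at this
    conv_lhs => rw [← this]
    rw [map_measureReal_apply (by fun_prop) measurableSet_Iio]
    congr 1
    ext x; simp
  have h2 : (gaussianReal 0 1).real (Set.Iic 0) = (gaussianReal 0 1).real (Set.Iio 0) :=
    measureReal_congr Iio_ae_eq_Iic.symm
  have h3 := probReal_compl_eq_one_sub (μ := gaussianReal 0 1) (s := Set.Ioi 0) measurableSet_Ioi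
  rw [Set.compl_Ioi, h2, h1] at h3
  linarith

open ProbabilityTheory in
lemma gauss_small {ε : ℝ} (hε : 0 < ε) : ∃ δ > 0, (gaussianReal 0 1).real (Set.Icc (-δ) δ) < ε := by
  have : NullSingletonClass (gaussianReal 0 1) := nullSingletonClass_gaussianReal one_ne_zero
  have h : Tendsto (fun k : ℕ => (gaussianReal 0 1) (Set.Icc (-(1 / ((k : ℝ) + 1))) (1 / ((k : ℝ) + 1))))
      atTop (𝓝 ((gaussianReal 0 1) (⋂ k : ℕ, Set.Icc (-(1 / ((k : ℝ) + 1))) (1 / ((k : ℝ) + 1))))) := by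
    refine tendsto_measure_iInter_atTop (fun k => measurableSet_Icc.nullMeasurableSet) ?_
      ⟨0, measure_ne_top _ _⟩
    intro a b hab
    have : 1 / ((b : ℝ) + 1) ≤ 1 / ((a : ℝ) + 1) := by gcongr
    exact Set.Icc_subset_Icc (by linarith) this
  have e : (⋂ k : ℕ, Set.Icc (-(1 / ((k : ℝ) + 1))) (1 / ((k : ℝ) + 1))) = {0} := by
    ext x
    simp only [Set.mem_iInter, Set.mem_singleton_iff, Set.mem_Icc, ← abs_le]
    constructor
    · intro h
      have : |x| ≤ 0 := ge_of_tendsto' tendsto_one_div_add_atTop_nhds_zero_nat h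
      exact abs_nonpos_iff.1 this
    · rintro rfl k; simp; positivity
  rw [e, measure_singleton] at h
  have h2 := (ENNReal.tendsto_toReal ENNReal.zero_ne_top).comp h
  obtain ⟨k, hk⟩ := (h2.eventually_lt_const (by simpa using hε)).exists
  exact ⟨1 / ((k : ℝ) + 1), by positivity, hk⟩

lemma frontier_Icc_null (a b : ℝ) : volume (frontier (Set.Icc a b)) = 0 :=
  (convex_Icc a b).addHaar_frontier volume
lemma frontier_Ioi_null (a : ℝ) : volume (frontier (Set.Ioi a)) = 0 :=
  (convex_Ioi a).addHaar_frontier volume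

lemma uniform_half {ε : ℝ} (hε : 0 < ε) : ∃ η > 0, ∃ N : ℕ, ∀ n ≥ N, ∀ g : ℕ → ℝ,
    ∑ b ∈ Icc 1 n, g b = 0 → ∑ b ∈ Icc 1 n, g b * Yc n b = 0 → ∑ b ∈ Icc 1 n, g b ^ 2 = n →
    (∀ b ∈ Icc 1 n, |g b| ≤ η * √n) →
    |(#((dieFinset n).filter fun B => 0 < ∑ i, g (B i)) : ℝ) / #(dieFinset n) - 1 / 2| ≤ ε := by
  classical
  by_contra! hcon
  have hk : ∀ k : ℕ, ∃ n ≥ k + 2, ∃ g : ℕ → ℝ,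
    ∑ b ∈ Icc 1 n, g b = 0 ∧ ∑ b ∈ Icc 1 n, g b * Yc n b = 0 ∧ ∑ b ∈ Icc 1 n, g b ^ 2 = n ∧
    (∀ b ∈ Icc 1 n, |g b| ≤ (1 / ((k : ℝ) + 1)) * √n) ∧
    ε < |(#((dieFinset n).filter fun B => 0 < ∑ i, g (B i)) : ℝ) / #(dieFinset n) - 1 / 2| := by
    intro k
    obtain ⟨n, hn, g, h⟩ := hcon (1 / ((k : ℝ) + 1)) (by positivity) (k + 2)
    exact ⟨n, hn, g, h⟩
  choose n hn g h0 h1 h2 h3 h4 using hk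
  have H : GoodSeq n g (fun k => 1 / ((k : ℝ) + 1)) 1 := by
    refine ⟨fun k => by have := hn k; omega, ?_, tendsto_one_div_add_atTop_nhds_zero_nat, h0, h1,
      fun k => by rw [h2, one_mul], h3⟩
    exact tendsto_atTop_mono (fun k => by have := hn k; simp only [id]; omega) tendsto_id
  have hl := die_clt H (E := Set.Ioi 0) measurableSet_Ioi (frontier_Ioi_null 0)
  rw [gauss_half] at hl
  obtain ⟨k, hk⟩ := ((Metric.tendsto_nhds.1 hl) ε hε).exists
  rw [Real.dist_eq] at hk
  refine absurd hk (not_lt.2 (le_of_lt ?_))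
  refine lt_of_lt_of_eq (h4 k) ?_
  congr 4
  have hs : 0 < √(n k : ℝ) := Real.sqrt_pos.2 (by have := hn k; exact_mod_cast (by omega : 0 < n k))
  simp only [Set.mem_Ioi]
  congr 1
  refine Finset.filter_congr fun B _ => ?_
  rw [lt_div_iff₀ hs, zero_mul]

/-- the cubic test function -/
noncomputable def Wc (n : ℕ) (b : ℕ) : ℝ := Yc n b ^ 3 - (3 * (n : ℝ) ^ 2 - 7) / 20 * Yc n b

lemma Wc_sum0 (n : ℕ) : ∑ b ∈ Icc 1 n, Wc n b = 0 := by
  unfold Wc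
  rw [Finset.sum_sub_distrib, ← Finset.mul_sum, ysum3, ysum1]; simp

lemma Wc_sum1 (n : ℕ) : ∑ b ∈ Icc 1 n, Wc n b * Yc n b = 0 := by
  have : ∀ b, Wc n b * Yc n b = Yc n b ^ 4 - (3 * (n : ℝ) ^ 2 - 7) / 20 * Yc n b ^ 2 := by
    intro b; unfold Wc; ring
  simp_rw [this]
  rw [Finset.sum_sub_distrib, ← Finset.mul_sum, ysum4, ysum2]; ring

lemma Wc_sum2 (n : ℕ) : ∑ b ∈ Icc 1 n, Wc n b ^ 2 =
    n * ((n ^ 2 - 1) * (n ^ 2 - 4) * (n ^ 2 - 9) / 2800) := by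
  have : ∀ b, Wc n b ^ 2 = Yc n b ^ 6 - 2 * ((3 * (n : ℝ) ^ 2 - 7) / 20) * Yc n b ^ 4 +
      ((3 * (n : ℝ) ^ 2 - 7) / 20) ^ 2 * Yc n b ^ 2 := by
    intro b; unfold Wc; ring
  simp_rw [this]
  rw [Finset.sum_add_distrib, Finset.sum_sub_distrib, ← Finset.mul_sum, ← Finset.mul_sum,
    ysum6, ysum4, ysum2]; ring

noncomputable def tau (n : ℕ) : ℝ := √(((n : ℝ) ^ 2 - 1) * (n ^ 2 - 4) * (n ^ 2 - 9) / 2800)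

lemma tau_sq_ge {n : ℕ} (hn : 4 ≤ n) :
    ((n : ℝ) ^ 3 / 100) ^ 2 ≤ ((n : ℝ) ^ 2 - 1) * (n ^ 2 - 4) * (n ^ 2 - 9) / 2800 := by
  have hn' : (4 : ℝ) ≤ n := by exact_mod_cast hn
  have h1 : 15 / 16 * (n : ℝ) ^ 2 ≤ (n : ℝ) ^ 2 - 1 := by nlinarith
  have h2 : 3 / 4 * (n : ℝ) ^ 2 ≤ (n : ℝ) ^ 2 - 4 := by nlinarith
  have h3 : 7 / 16 * (n : ℝ) ^ 2 ≤ (n : ℝ) ^ 2 - 9 := by nlinarith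
  have h4 : (15 / 16 * (n : ℝ) ^ 2) * (3 / 4 * (n : ℝ) ^ 2) * (7 / 16 * (n : ℝ) ^ 2) ≤
    ((n : ℝ) ^ 2 - 1) * (n ^ 2 - 4) * (n ^ 2 - 9) := by
    have p : 0 ≤ (n : ℝ) ^ 2 := by positivity
    have q1 : 0 ≤ (n : ℝ) ^ 2 - 1 := by linarith
    have q2 : 0 ≤ (n : ℝ) ^ 2 - 4 := by linarith
    gcongr <;> first | positivity | exact mul_nonneg q1 q2 | linarith
  have h5 : 0 ≤ (n : ℝ) ^ 6 := by positivity
  nlinarith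

lemma tau_ge {n : ℕ} (hn : 4 ≤ n) : (n : ℝ) ^ 3 / 100 ≤ tau n :=
  Real.le_sqrt_of_sq_le (tau_sq_ge hn)

lemma Wc_bound {n b : ℕ} (hn : 4 ≤ n) (hb : b ∈ Icc 1 n) : |Wc n b| ≤ (n : ℝ) ^ 3 / 5 := by
  have hn' : (4 : ℝ) ≤ n := by exact_mod_cast hn
  have hy := abs_Yc_le hb
  unfold Wc
  refine (abs_sub _ _).trans ?_
  rw [abs_pow, abs_mul, abs_of_nonneg (by nlinarith : (0:ℝ) ≤ (3 * (n : ℝ) ^ 2 - 7) / 20)]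
  have h1 : |Yc n b| ^ 3 ≤ ((n : ℝ) / 2) ^ 3 := by gcongr
  have h2 : (3 * (n : ℝ) ^ 2 - 7) / 20 * |Yc n b| ≤ (3 * (n : ℝ) ^ 2) / 20 * ((n : ℝ) / 2) := by
    gcongr
    linarith
  nlinarith

lemma small_ball {ε : ℝ} (hε : 0 < ε) : ∃ δ > 0, ∀ᶠ n : ℕ in atTop,
    (#((dieFinset n).filter fun A => |∑ i, Yc n (A i) ^ 3| ≤ δ * ((n : ℝ) ^ 3 * √n)) : ℝ) /
      #(dieFinset n) ≤ ε := by
  classical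
  obtain ⟨δ, hδ, hd⟩ := gauss_small hε
  refine ⟨δ / 100, by positivity, ?_⟩
  have hN : Tendsto (fun k : ℕ => ((k + 4 : ℕ) : ℝ)) atTop atTop :=
    tendsto_natCast_atTop_atTop.comp (tendsto_add_atTop_nat 4)
  have H : GoodSeq (fun k => k + 4) (fun k b => Wc (k + 4) b / tau (k + 4))
      (fun k => 20 / √((k + 4 : ℕ) : ℝ)) 1 := by
    have tp : ∀ k : ℕ, 0 < tau (k + 4) := fun k =>
      lt_of_lt_of_le (by positivity) (tau_ge (n := k + 4) (by omega))
    refine ⟨fun k => by omega, tendsto_add_atTop_nat 4,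
      (Real.tendsto_sqrt_atTop.comp hN).const_div_atTop _, ?_, ?_, ?_, ?_⟩
    · intro k; rw [← Finset.sum_div, Wc_sum0, zero_div]
    · intro k
      simp_rw [div_mul_eq_mul_div]
      rw [← Finset.sum_div, Wc_sum1, zero_div]
    · intro k
      simp_rw [div_pow]
      rw [← Finset.sum_div, Wc_sum2, div_eq_iff (pow_pos (tp k) 2).ne', tau, Real.sq_sqrt]
      · ring
      · exact le_trans (by positivity) (tau_sq_ge (n := k + 4) (by omega))
    · intro k b hb
      have hs : 0 < √((k + 4 : ℕ) : ℝ) := Real.sqrt_pos.2 (by positivity)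
      rw [div_mul_cancel₀ _ hs.ne', abs_div, abs_of_pos (tp k), div_le_iff₀ (tp k)]
      have h1 := Wc_bound (n := k + 4) (by omega) hb
      have h2 := tau_ge (n := k + 4) (by omega)
      linarith
  have hl := die_clt H (E := Set.Icc (-δ) δ) measurableSet_Icc (frontier_Icc_null _ _)
  rw [← map_add_atTop_eq_nat 4, Filter.eventually_map]
  filter_upwards [hl.eventually_lt_const hd] with k hk
  refine le_trans ?_ hk.le
  gcongr with B hB
  intro hle
  have hs : 0 < √((k + 4 : ℕ) : ℝ) := Real.sqrt_pos.2 (by positivity)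
  have ht := tau_ge (n := k + 4) (by omega)
  have htp : 0 < tau (k + 4) := lt_of_lt_of_le (by positivity) ht
  rw [Set.mem_Icc, ← abs_le, ← Finset.sum_div, abs_div, abs_div, abs_of_pos hs, abs_of_pos htp,
    div_div, div_le_iff₀ (by positivity)]
  have e : ∑ i, Wc (k + 4) (B i) = ∑ i, Yc (k + 4) (B i) ^ 3 := by
    unfold Wc
    rw [Finset.sum_sub_distrib, ← Finset.mul_sum, ((mem_die B).1 hB).2]; simp
  rw [e]
  refine hle.trans ?_
  have : δ * (((k + 4 : ℕ) : ℝ) ^ 3 / 100 * √((k + 4 : ℕ) : ℝ)) ≤ δ * (tau (k + 4) * √((k + 4 : ℕ) : ℝ)) := by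
    gcongr
  linarith

end

section
open Finset

lemma card_filter_real {ι : Type*} (s : Finset ι) (p : ι → Prop) [DecidablePred p] :
    ((#(s.filter p) : ℕ) : ℝ) = ∑ i ∈ s, if p i then (1 : ℝ) else 0 := by
  simp

/-- kernel -/
noncomputable def kk (a b : ℕ) : ℝ := (if a < b then (1 : ℝ) else 0) + (1 / 2) * (if a = b then (1 : ℝ) else 0)

lemma kk_eq (a b : ℕ) : kk a b = 1 / 2 + (1 / 2) * ((if a < b then (1 : ℝ) else 0) - if b < a then 1 else 0) := by
  unfold kk
  rcases lt_trichotomy a b with h | h | h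
  · simp [h, h.ne, h.not_gt]; norm_num
  · simp [h]
  · simp [h, h.ne', h.not_gt]

lemma gA_eq {n : ℕ} (A : Fin n → ℕ) (b : ℕ) : gA A b = ∑ i, kk (A i) b - b + 1 / 2 := by
  unfold gA fA kk
  rw [Finset.sum_add_distrib, ← Finset.mul_sum, card_filter_real, card_filter_real]

lemma beats_iff {n : ℕ} (A B : Fin n → ℕ) (hB : B ∈ dieFinset n) :
    beats B A ↔ 0 < ∑ i, gA A (B i) := by
  have hs := ((mem_die B).1 hB).2
  have e1 : ∑ i, gA A (B i) = (1 / 2) *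
     ((#((Finset.univ : Finset (Fin n × Fin n)).filter fun p => A p.2 < B p.1) : ℝ)
      - #((Finset.univ : Finset (Fin n × Fin n)).filter fun p => B p.1 < A p.2)) := by
    rw [card_filter_real, card_filter_real, ← Finset.univ_product_univ, Finset.sum_product,
      Finset.sum_product, ← Finset.sum_sub_distrib, Finset.mul_sum]
    have h : ∀ i, gA A (B i) = (1 / 2) * ((∑ j, if A j < B i then (1 : ℝ) else 0) -
        ∑ j, if B i < A j then (1 : ℝ) else 0) - Yc n (B i) := by
      intro i
      rw [gA_eq, ← Finset.sum_sub_distrib]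
      simp_rw [kk_eq]
      rw [Finset.sum_add_distrib, ← Finset.mul_sum, Yc, Finset.sum_const, Finset.card_univ,
        Fintype.card_fin, nsmul_eq_mul]
      ring
    simp_rw [h]
    rw [Finset.sum_sub_distrib, hs, sub_zero]
  rw [e1]
  unfold beats
  constructor
  · intro h
    have : (#((Finset.univ : Finset (Fin n × Fin n)).filter fun p => B p.1 < A p.2) : ℝ) <
      #((Finset.univ : Finset (Fin n × Fin n)).filter fun p => A p.2 < B p.1) := by exact_mod_cast h
    linarith
  · intro h
    have : (#((Finset.univ : Finset (Fin n × Fin n)).filter fun p => B p.1 < A p.2) : ℝ) <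
      #((Finset.univ : Finset (Fin n × Fin n)).filter fun p => A p.2 < B p.1) := by linarith
    exact_mod_cast this

/-- sums of a function against the kernel, as telescoping -/
lemma kk_sum (f F : ℕ → ℝ) (hF : ∀ b, F (b + 1) = F b + f (b + 1)) (a N : ℕ) (h1 : 1 ≤ a) (hN : a ≤ N) :
    ∑ b ∈ Icc 1 N, f b * kk a b = F N - F a + f a / 2 := by
  induction N, hN using Nat.le_induction with
  | base =>
    obtain ⟨a, rfl⟩ : ∃ c, a = c + 1 := ⟨a - 1, by omega⟩
    rw [Finset.sum_eq_single_of_mem (a + 1) (by simp)]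
    · simp [kk]; ring
    · intro b hb hne
      have := (Finset.mem_Icc.1 hb).2
      simp [kk, (Ne.symm hne), not_lt.2 this]
  | succ N hN ih =>
    rw [Finset.sum_Icc_succ_top (by omega), ih, hF]
    have : a < N + 1 := by omega
    simp [kk, this, this.ne]
    ring

lemma gA_sum0 {n : ℕ} (A : Fin n → ℕ) (hA : A ∈ dieFinset n) : ∑ b ∈ Icc 1 n, gA A b = 0 := by
  have hs := ((mem_die A).1 hA).2
  have h1 : ∑ b ∈ Icc 1 n, ∑ i, kk (A i) b = (n:ℝ) * n / 2 := by
    rw [Finset.sum_comm]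
    have : ∀ i, ∑ b ∈ Icc 1 n, kk (A i) b = (n : ℝ) / 2 - Yc n (A i) := by
      intro i
      have hi := Finset.mem_Icc.1 (die_range hA i)
      have := kk_sum (fun _ => 1) (fun b => b) (by intro b; push_cast; ring) (A i) n hi.1 hi.2
      simp only [one_mul] at this
      rw [this, Yc]; ring
    simp_rw [this]
    rw [Finset.sum_sub_distrib, hs]; simp; ring
  simp_rw [gA_eq]
  have h2 : ∀ b, ∑ i, kk (A i) b - b + 1 / 2 = ∑ i, kk (A i) b - Yc n b - (n:ℝ)/2 := by
    intro b; rw [Yc]; ring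
  simp_rw [h2]
  rw [Finset.sum_sub_distrib, Finset.sum_sub_distrib, h1, ysum1]; simp; ring

lemma gA_sum2 {n : ℕ} (A : Fin n → ℕ) (hA : A ∈ dieFinset n) :
    ∑ b ∈ Icc 1 n, Yc n b ^ 2 * gA A b = - (1 / 3) * ∑ i, Yc n (A i) ^ 3 := by
  have hs := ((mem_die A).1 hA).2
  -- F b = Y^3/3 + Y^2/2 + Y/6
  have h1 : ∑ b ∈ Icc 1 n, ∑ i, Yc n b ^ 2 * kk (A i) b =
      n * (Yc n n ^ 3 / 3 + Yc n n ^ 2 / 2 + Yc n n / 6) - (1 / 3) * ∑ i, Yc n (A i) ^ 3 := by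
    rw [Finset.sum_comm]
    have : ∀ i, ∑ b ∈ Icc 1 n, Yc n b ^ 2 * kk (A i) b =
        (Yc n n ^ 3 / 3 + Yc n n ^ 2 / 2 + Yc n n / 6) - (1 / 3) * Yc n (A i) ^ 3 - (1 / 6) * Yc n (A i) := by
      intro i
      have hi := Finset.mem_Icc.1 (die_range hA i)
      rw [kk_sum (fun b => Yc n b ^ 2) (fun b => Yc n b ^ 3 / 3 + Yc n b ^ 2 / 2 + Yc n b / 6)
        (by intro b; simp only [Yc]; push_cast; ring) (A i) n hi.1 hi.2]
      ring
    simp_rw [this]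
    rw [Finset.sum_sub_distrib, Finset.sum_sub_distrib, ← Finset.mul_sum, ← Finset.mul_sum, hs,
      Finset.sum_const, Finset.card_univ, Fintype.card_fin, nsmul_eq_mul]; ring
  simp_rw [gA_eq]
  have h2 : ∀ b, Yc n b ^ 2 * (∑ i, kk (A i) b - b + 1 / 2) =
      ∑ i, Yc n b ^ 2 * kk (A i) b - Yc n b ^ 3 - (n : ℝ) / 2 * Yc n b ^ 2 := by
    intro b; rw [← Finset.mul_sum, Yc]; ring
  simp_rw [h2]
  rw [Finset.sum_sub_distrib, Finset.sum_sub_distrib, h1, ysum3, ← Finset.mul_sum, ysum2]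
  simp only [Yc]
  ring

/-- Chernoff -/
lemma chernoff {n : ℕ} (φ : ℕ → ℝ) (h0 : ∑ a ∈ Icc 1 n, φ a = 0) (h1 : ∀ a ∈ Icc 1 n, |φ a| ≤ 1)
    {η : ℝ} (hη : 0 < η) (hη1 : η ≤ 1) :
    (#((Fintype.piFinset fun _ : Fin n => Icc 1 n).filter fun A => η * n < ∑ i, φ (A i)) : ℝ) ≤
      (n : ℝ) ^ n * Real.exp (-(η ^ 2 / 4) * n) := by
  have hexp : ∀ a ∈ Icc 1 n, Real.exp (η / 2 * φ a) ≤ 1 + η / 2 * φ a + η ^ 2 / 4 := by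
    intro a ha
    have hp := h1 a ha
    have hx : |η / 2 * φ a| ≤ 1 := by
      rw [abs_mul, abs_of_pos (by positivity)]
      nlinarith [abs_nonneg (φ a)]
    have := Real.abs_exp_sub_one_sub_id_le hx
    have h2 := (abs_le.1 this).2
    have h3 : φ a ^ 2 ≤ 1 := by rw [← sq_abs]; nlinarith [abs_nonneg (φ a)]
    nlinarith [sq_nonneg η]
  have hsum : ∑ a ∈ Icc 1 n, Real.exp (η / 2 * φ a) ≤ n * Real.exp (η ^ 2 / 4) := by
    refine (Finset.sum_le_sum hexp).trans ?_
    rw [Finset.sum_add_distrib, Finset.sum_add_distrib, ← Finset.mul_sum, h0]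
    simp only [Finset.sum_const, Nat.card_Icc, nsmul_eq_mul]
    have := Real.add_one_le_exp (η ^ 2 / 4)
    have hn : (0 : ℝ) ≤ n := by positivity
    simp only [Nat.add_sub_cancel]
    nlinarith
  have hprod : ∑ A ∈ Fintype.piFinset (fun _ : Fin n => Icc 1 n), Real.exp (η / 2 * ∑ i, φ (A i)) =
      (∑ a ∈ Icc 1 n, Real.exp (η / 2 * φ a)) ^ n := by
    have := Finset.prod_univ_sum (fun _ : Fin n => Icc 1 n) (fun _ a => Real.exp (η / 2 * φ a))
    rw [Finset.prod_const, Finset.card_univ, Fintype.card_fin] at this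
    rw [this]
    refine Finset.sum_congr rfl fun A _ => ?_
    rw [Finset.mul_sum, Real.exp_sum]
  have hle : (#((Fintype.piFinset fun _ : Fin n => Icc 1 n).filter fun A => η * n < ∑ i, φ (A i)) : ℝ) *
      Real.exp (η / 2 * (η * n)) ≤ (∑ a ∈ Icc 1 n, Real.exp (η / 2 * φ a)) ^ n := by
    rw [← hprod, ← nsmul_eq_mul]
    refine (Finset.card_nsmul_le_sum _ (fun A => Real.exp (η / 2 * ∑ i, φ (A i))) _ ?_).trans ?_
    · intro A hA
      have := (Finset.mem_filter.1 hA).2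
      gcongr
    · exact Finset.sum_le_sum_of_subset_of_nonneg (Finset.filter_subset _ _)
        (fun _ _ _ => (Real.exp_pos _).le)
  have h3 : (∑ a ∈ Icc 1 n, Real.exp (η / 2 * φ a)) ^ n ≤ (n * Real.exp (η ^ 2 / 4)) ^ n := by
    gcongr
  have h4 := hle.trans h3
  rw [← le_div_iff₀ (Real.exp_pos _)] at h4
  refine h4.trans (le_of_eq ?_)
  rw [mul_pow, ← Real.exp_nat_mul, mul_div_assoc, ← Real.exp_sub]
  congr 2
  ring

end

section
open Finset
open Filter Topology

lemma kk_compl (a b : ℕ) : kk a b = 1 - kk b a := by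
  rw [kk_eq, kk_eq]; ring

lemma kk_mem (a b : ℕ) : 0 ≤ kk a b ∧ kk a b ≤ 1 := by
  unfold kk
  rcases lt_trichotomy a b with h | h | h
  · simp [h, h.ne]
  · simp [h]; norm_num
  · simp [h.ne', h.not_gt]

noncomputable def phi (n b a : ℕ) : ℝ := kk a b - ((b : ℝ) - 1 / 2) / n

lemma phi_sum0 {n b : ℕ} (hb : b ∈ Icc 1 n) : ∑ a ∈ Icc 1 n, phi n b a = 0 := by
  have hi := Finset.mem_Icc.1 hb
  have := kk_sum (fun _ => 1) (fun b => b) (by intro b; push_cast; ring) b n hi.1 hi.2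
  simp only [one_mul] at this
  unfold phi
  simp_rw [fun a => kk_compl a b]
  rw [Finset.sum_sub_distrib, Finset.sum_sub_distrib, this, Finset.sum_const, Finset.sum_const,
    Nat.card_Icc, nsmul_eq_mul, nsmul_eq_mul, Nat.add_sub_cancel]
  have hn : (n : ℝ) ≠ 0 := by have : n ≠ 0 := by omega
                              exact_mod_cast this
  field_simp
  ring

lemma phi_bound {n b : ℕ} (hb : b ∈ Icc 1 n) (a : ℕ) : |phi n b a| ≤ 1 := by
  have hi := Finset.mem_Icc.1 hb
  have h1 : (1 : ℝ) ≤ b := by exact_mod_cast hi.1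
  have h2 : (b : ℝ) ≤ n := by exact_mod_cast hi.2
  have hn : (0 : ℝ) < n := by linarith
  have h3 : 0 ≤ ((b : ℝ) - 1 / 2) / n := div_nonneg (by linarith) hn.le
  have h4 : ((b : ℝ) - 1 / 2) / n ≤ 1 := by rw [div_le_one hn]; linarith
  have h5 := kk_mem a b
  unfold phi
  rw [abs_le]; constructor <;> linarith

lemma gA_phi {n : ℕ} (hn : 0 < n) (A : Fin n → ℕ) (b : ℕ) : gA A b = ∑ i, phi n b (A i) := by
  unfold phi
  rw [gA_eq, Finset.sum_sub_distrib, Finset.sum_const, Finset.card_univ, Fintype.card_fin, nsmul_eq_mul]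
  have hn : (n : ℝ) ≠ 0 := by exact_mod_cast hn.ne'
  field_simp
  ring

open Classical in
noncomputable def maxBad (n : ℕ) (η : ℝ) : Finset (Fin n → ℕ) :=
  (dieFinset n).filter fun A => ∃ b ∈ Icc 1 n, η * n < |gA A b|

lemma mem_maxBad {n : ℕ} {η : ℝ} {A : Fin n → ℕ} :
    A ∈ maxBad n η ↔ A ∈ dieFinset n ∧ ∃ b ∈ Icc 1 n, η * n < |gA A b| := by
  classical
  simp [maxBad]

lemma max_count {n : ℕ} (hn : 0 < n) {η : ℝ} (hη : 0 < η) (hη1 : η ≤ 1) :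
    (#(maxBad n η) : ℝ) ≤
      n * (2 * ((n : ℝ) ^ n * Real.exp (-(η ^ 2 / 4) * n))) := by
  classical
  let P := Fintype.piFinset fun _ : Fin n => Icc 1 n
  let S := fun b => (P.filter fun A => η * n < ∑ i, phi n b (A i)) ∪
    (P.filter fun A => η * n < ∑ i, - phi n b (A i))
  have hsub : maxBad n η ⊆ (Icc 1 n).biUnion S := by
    intro A hA
    obtain ⟨hA, b, hb, h⟩ := mem_maxBad.1 hA
    refine Finset.mem_biUnion.2 ⟨b, hb, ?_⟩
    have hP : A ∈ P := ((mem_die A).1 hA).1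
    rw [gA_phi hn, lt_abs] at h
    rcases h with h | h
    · exact Finset.mem_union_left _ (Finset.mem_filter.2 ⟨hP, h⟩)
    · refine Finset.mem_union_right _ (Finset.mem_filter.2 ⟨hP, ?_⟩)
      rw [Finset.sum_neg_distrib]; exact h
  have h1 : (#((Icc 1 n).biUnion S) : ℝ) ≤ ∑ b ∈ Icc 1 n, (#(S b) : ℝ) := by
    exact_mod_cast Finset.card_biUnion_le
  refine (Nat.cast_le.2 (Finset.card_le_card hsub)).trans (h1.trans ?_)
  have h2 : ∀ b ∈ Icc 1 n, (#(S b) : ℝ) ≤ 2 * ((n : ℝ) ^ n * Real.exp (-(η ^ 2 / 4) * n)) := by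
    intro b hb
    have c1 := chernoff (phi n b) (phi_sum0 hb) (fun a _ => phi_bound hb a) hη hη1
    have c2 := chernoff (fun a => - phi n b a) (by rw [Finset.sum_neg_distrib, phi_sum0 hb, neg_zero])
      (fun a _ => by rw [abs_neg]; exact phi_bound hb a) hη hη1
    have c3 : (#(S b) : ℝ) ≤ _ := Nat.cast_le.2 (Finset.card_union_le _ _)
    push_cast at c3
    refine c3.trans ?_
    linarith
  refine (Finset.sum_le_sum h2).trans ?_
  simp

lemma max_lim {η : ℝ} (hη : 0 < η) (hη1 : η ≤ 1) :
    Tendsto (fun n : ℕ => (#(maxBad n η) : ℝ) /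
      #(dieFinset n)) atTop (𝓝 0) := by
  set c := η ^ 2 / 4 with hc
  have hcp : 0 < c := by positivity
  have hl : Tendsto (fun n : ℕ => 4 * Real.pi / c ^ 3 * ((c * n) ^ 3 * Real.exp (-(c * n)))) atTop (𝓝 0) := by
    have := (Real.tendsto_pow_mul_exp_neg_atTop_nhds_zero 3).comp
      ((tendsto_natCast_atTop_atTop (R := ℝ)).const_mul_atTop hcp)
    simpa using this.const_mul (4 * Real.pi / c ^ 3)
  refine squeeze_zero' (Eventually.of_forall fun n => by positivity) ?_ hl
  have h24 : (1 : ℝ) < √(24 * Real.pi) := by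
    rw [Real.lt_sqrt (by norm_num)]; nlinarith [Real.pi_gt_three]
  filter_upwards [card_lim.eventually_const_lt h24, eventually_gt_atTop 0] with n h1 hn
  have hn1 : (1 : ℝ) ≤ n := by exact_mod_cast hn
  have hd := die_card_pos n
  rw [div_le_iff₀ hd]
  refine (max_count hn hη hη1).trans ?_
  have hp : (0 : ℝ) < (n : ℝ) ^ n := by positivity
  have h2 : (n : ℝ) ^ n ≤ n * √n * (2 * Real.pi) * #(dieFinset n) := by
    have : (n : ℝ) ^ n * 1 ≤ (n : ℝ) ^ n * (n * √n * (((n : ℝ) ^ n)⁻¹ * (2 * Real.pi) * #(dieFinset n))) := by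
      gcongr
    refine (mul_one _).symm.le.trans (this.trans (le_of_eq ?_))
    field_simp
  have h3 : √(n : ℝ) ≤ n := by
    rw [Real.sqrt_le_left (by positivity)]; nlinarith
  have h4 : (n : ℝ) ^ n ≤ n * n * (2 * Real.pi) * #(dieFinset n) := by
    refine h2.trans ?_
    gcongr
  calc (n : ℝ) * (2 * ((n : ℝ) ^ n * Real.exp (-c * n)))
      ≤ n * (2 * ((n * n * (2 * Real.pi) * #(dieFinset n)) * Real.exp (-c * n))) := by gcongr
    _ = _ := by
      rw [neg_mul]
      field_simp
      ring

lemma die_sum_sub {n : ℕ} {B : Fin n → ℕ} (hB : B ∈ dieFinset n) (h : ℕ → ℝ) (l s : ℝ) :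
    ∑ i, (h (B i) - l * Yc n (B i)) / s = (∑ i, h (B i)) / s := by
  rw [← Finset.sum_div, Finset.sum_sub_distrib, ← Finset.mul_sum, ((mem_die B).1 hB).2]; simp

lemma good_A {δ ε : ℝ} (hδ : 0 < δ) (hε : 0 < ε) : ∃ η > 0, η ≤ 1 ∧ ∃ N : ℕ, ∀ n ≥ N,
    ∀ A ∈ dieFinset n, δ * ((n : ℝ) ^ 3 * √n) < |∑ i, Yc n (A i) ^ 3| →
    (∀ b ∈ Icc 1 n, |gA A b| ≤ η * n) →
    |(#((dieFinset n).filter fun B => beats B A) : ℝ) / #(dieFinset n) - 1 / 2| ≤ ε := by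
  obtain ⟨η, hη, N, H⟩ := uniform_half hε
  refine ⟨min 1 (η * δ / 5), lt_min one_pos (by positivity), min_le_left _ _, max N 2, ?_⟩
  intro n hn A hA hbig hsm
  have hN : N ≤ n := (le_max_left _ _).trans hn
  have hn2 : 2 ≤ n := (le_max_right _ _).trans hn
  have hn2' : (2 : ℝ) ≤ n := by exact_mod_cast hn2
  have hnp : (0 : ℝ) < n := by linarith
  set κ := η * δ / 5 with hκ
  have hκp : 0 < κ := by positivity
  have hsm' : ∀ b ∈ Icc 1 n, |gA A b| ≤ κ * n := fun b hb =>
    (hsm b hb).trans (by gcongr; exact min_le_right _ _)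
  set l : ℝ := (∑ b ∈ Icc 1 n, gA A b * Yc n b) / (n * (n ^ 2 - 1) / 12) with hl
  have hden : (n : ℝ) ^ 3 / 16 ≤ n * (n ^ 2 - 1) / 12 := by nlinarith [mul_pos hnp hnp]
  have hden0 : (0 : ℝ) < n * (n ^ 2 - 1) / 12 := lt_of_lt_of_le (by positivity) hden
  have hlb : |l| ≤ 8 * κ := by
    rw [hl, abs_div, abs_of_pos hden0, div_le_iff₀ hden0]
    have h1 : |∑ b ∈ Icc 1 n, gA A b * Yc n b| ≤ ∑ b ∈ Icc 1 n, κ * n * (n / 2) := by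
      refine (Finset.abs_sum_le_sum_abs _ _).trans (Finset.sum_le_sum fun b hb => ?_)
      rw [abs_mul]
      exact mul_le_mul (hsm' b hb) (abs_Yc_le hb) (abs_nonneg _) (by positivity)
    rw [Finset.sum_const, Nat.card_Icc, nsmul_eq_mul, Nat.add_sub_cancel] at h1
    have h2 : 8 * κ * ((n : ℝ) ^ 3 / 16) ≤ 8 * κ * (n * (n ^ 2 - 1) / 12) := by gcongr
    refine h1.trans (le_trans (le_of_eq ?_) h2)
    ring
  set h : ℕ → ℝ := fun b => gA A b - l * Yc n b with hh
  have hhb : ∀ b ∈ Icc 1 n, |h b| ≤ 5 * κ * n := by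
    intro b hb
    refine (abs_sub _ _).trans ?_
    have h1 : |l * Yc n b| ≤ 8 * κ * (n / 2) := by
      rw [abs_mul]
      exact mul_le_mul hlb (abs_Yc_le hb) (abs_nonneg _) (by positivity)
    have := hsm' b hb
    linarith
  have hs0 : ∑ b ∈ Icc 1 n, h b = 0 := by
    rw [hh, Finset.sum_sub_distrib, ← Finset.mul_sum, gA_sum0 A hA, ysum1]; simp
  have hs1 : ∑ b ∈ Icc 1 n, h b * Yc n b = 0 := by
    have : ∀ b, h b * Yc n b = gA A b * Yc n b - l * Yc n b ^ 2 := by intro b; rw [hh]; ring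
    simp_rw [this]
    rw [Finset.sum_sub_distrib, ← Finset.mul_sum, ysum2, hl, div_mul_cancel₀ _ hden0.ne', sub_self]
  have hs2 : ∑ b ∈ Icc 1 n, Yc n b ^ 2 * h b = - (1 / 3) * ∑ i, Yc n (A i) ^ 3 := by
    have : ∀ b, Yc n b ^ 2 * h b = Yc n b ^ 2 * gA A b - l * Yc n b ^ 3 := by intro b; rw [hh]; ring
    simp_rw [this]
    rw [Finset.sum_sub_distrib, ← Finset.mul_sum, ysum3, gA_sum2 A hA]; simp
  have hcs := Finset.sum_mul_sq_le_sq_mul_sq (Icc 1 n) (fun b => Yc n b ^ 2) h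
  rw [hs2] at hcs
  have h4 : ∑ b ∈ Icc 1 n, (Yc n b ^ 2) ^ 2 ≤ (n : ℝ) ^ 5 / 16 := by
    have : ∀ b ∈ Icc 1 n, (Yc n b ^ 2) ^ 2 ≤ (n : ℝ) ^ 4 / 16 := by
      intro b hb
      have := abs_Yc_le hb
      rw [← pow_mul, ← Even.pow_abs (by decide)]
      calc |Yc n b| ^ (2 * 2) ≤ ((n : ℝ) / 2) ^ (2 * 2) := by gcongr
        _ = _ := by ring
    refine (Finset.sum_le_sum this).trans (le_of_eq ?_)
    rw [Finset.sum_const, Nat.card_Icc, nsmul_eq_mul, Nat.add_sub_cancel]; ring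
  set Q := ∑ b ∈ Icc 1 n, h b ^ 2 with hQ
  have hQ0 : 0 ≤ Q := Finset.sum_nonneg fun b _ => sq_nonneg _
  have hbig2 : (δ * ((n : ℝ) ^ 3 * √n)) ^ 2 ≤ (∑ i, Yc n (A i) ^ 3) ^ 2 := by
    rw [← sq_abs (∑ i, Yc n (A i) ^ 3)]
    gcongr
  have hsq : √(n : ℝ) ^ 2 = n := Real.sq_sqrt hnp.le
  have hQlow : δ ^ 2 * (n : ℝ) ^ 2 ≤ Q := by
    have e1 : (δ * ((n : ℝ) ^ 3 * √n)) ^ 2 = δ ^ 2 * n ^ 7 := by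
      rw [mul_pow, mul_pow, hsq]; ring
    rw [e1] at hbig2
    have e2 : (1 / 9) * (δ ^ 2 * (n : ℝ) ^ 7) ≤ (n : ℝ) ^ 5 / 16 * Q := by
      have := mul_le_mul_of_nonneg_right h4 hQ0
      nlinarith
    have e3 : δ ^ 2 * (n : ℝ) ^ 2 * (n : ℝ) ^ 5 ≤ Q * (n : ℝ) ^ 5 := by
      have : 0 ≤ δ ^ 2 * (n : ℝ) ^ 7 := by positivity
      nlinarith
    exact le_of_mul_le_mul_right e3 (by positivity)
  set s := √(Q / n) with hsdef
  have hslow : δ * √n ≤ s := by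
    refine Real.le_sqrt_of_sq_le ?_
    rw [mul_pow, hsq, le_div_iff₀ hnp]
    linarith
  have hsn : 0 < √(n : ℝ) := Real.sqrt_pos.2 hnp
  have hsp : 0 < s := lt_of_lt_of_le (by positivity) hslow
  have hss : s ^ 2 = Q / n := Real.sq_sqrt (by positivity)
  have key := H n hN (fun b => h b / s) (by rw [← Finset.sum_div, hs0, zero_div])
    (by simp_rw [div_mul_eq_mul_div]; rw [← Finset.sum_div, hs1, zero_div])
    (by
      simp_rw [div_pow]
      rw [← Finset.sum_div, ← hQ, div_eq_iff (pow_pos hsp 2).ne', hss]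
      field_simp)
    (by
      intro b hb
      rw [abs_div, abs_of_pos hsp, div_le_iff₀ hsp]
      refine (hhb b hb).trans ?_
      calc 5 * κ * (n : ℝ) = η * √n * (δ * √n) := by rw [hκ]; nlinarith
        _ ≤ _ := by gcongr)
  convert key using 6
  refine Finset.filter_congr fun B hB => ?_
  rw [beats_iff A B hB, hh, die_sum_sub hB, lt_div_iff₀ hsp, zero_mul]


end

/-- for a uniformly random n-sided die A (balanced sequences model) and
any ε > 0, the probability over A that the proportion of dice B beating A differs from
1/2 by more than ε tends to 0. -/
theorem proportion_beating_close_to_half (ε : ℝ) (hε : 0 < ε) :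
    Filter.Tendsto
      (fun n : ℕ =>
        (((dieFinset n).filter fun A =>
            ε < |(((dieFinset n).filter fun B => beats B A).card : ℝ) /
              (dieFinset n).card - 1 / 2|).card : ℝ) / (dieFinset n).card)
      Filter.atTop (nhds 0) := by
  classical
  rw [Metric.tendsto_nhds]
  intro r hr
  obtain ⟨δ, hδ, h1⟩ := small_ball (half_pos hr)
  obtain ⟨η, hη, hη1, N, h2⟩ := good_A hδ hε
  filter_upwards [h1, (max_lim hη hη1).eventually_lt_const (half_pos hr),
    Filter.eventually_ge_atTop N] with n a1 a2 hn
  rw [Real.dist_eq, sub_zero, abs_of_nonneg (by positivity)]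
  refine lt_of_le_of_lt ?_ (by linarith [add_lt_add_of_le_of_lt a1 a2] :
    (#((dieFinset n).filter fun A => |∑ i, Yc n (A i) ^ 3| ≤ δ * ((n : ℝ) ^ 3 * √n)) : ℝ) /
      #(dieFinset n) + (#(maxBad n η) : ℝ) /
      #(dieFinset n) < r)
  rw [← add_div]
  have hd := die_card_pos n
  gcongr
  rw [← Nat.cast_add, Nat.cast_le]
  refine (Finset.card_le_card ?_).trans (Finset.card_union_le _ _)
  intro A hA
  obtain ⟨hA, hbad⟩ := Finset.mem_filter.1 hA
  by_contra hcon
  rw [Finset.mem_union, not_or, Finset.mem_filter, mem_maxBad] at hcon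
  obtain ⟨c1, c2⟩ := hcon
  refine absurd (h2 n hn A hA ?_ ?_) (not_le.2 hbad)
  · exact not_le.1 fun h => c1 ⟨hA, h⟩
  · intro b hb
    exact not_lt.1 fun h => c2 ⟨hA, b, hb, h⟩
end

section
/- Let a_1,…,a_n be independent random variables, each uniformly distributed on {1,…,n}, and let S = a_1+…+a_n. Then the probability mass function of S is symmetric about n(n+1)/2 and is maximized there: for every integer m, P[S = m] ≤ P[S = n(n+1)/2], and moreover for every integer m ≥ n(n+1)/2 one has P[S = m+1] ≤ P[S = m]. -/
open Finset

/-- The probability that the sum of `n` independent uniform random elements of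
`{1,…,n}` equals the integer `m`. -/
noncomputable def sumProb (n : ℕ) (m : ℤ) : ℝ :=
  (((Fintype.piFinset fun _ : Fin n => Finset.Icc 1 n).filter
      fun a => (∑ i, (a i : ℤ)) = m).card : ℝ) / (n : ℝ) ^ n

def convCnt (N : ℕ) : ℕ → ℤ → ℕ
  | 0, m => if m = 0 then 1 else 0
  | k + 1, m => ∑ j ∈ Finset.range N, convCnt N k (m - 1 - (j : ℤ))

theorem convCnt_symm (N k : ℕ) : ∀ m : ℤ,
    convCnt N k m = convCnt N k ((k : ℤ) * (N + 1) - m) := by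
  induction k with
  | zero => intro m; simp [convCnt]
  | succ k ih =>
    intro m
    simp only [convCnt]
    rw [← Finset.sum_range_reflect]
    apply Finset.sum_congr rfl
    intro j hj
    rw [Finset.mem_range] at hj
    rw [ih]
    congr 1
    have : ((N - 1 - j : ℕ) : ℤ) = N - 1 - j := by omega
    rw [this]; push_cast; ring

theorem le_of_symm_mono (f : ℤ → ℕ) (M : ℤ) (hs : ∀ m, f m = f (M - m))
    (hm : ∀ m, M ≤ 2 * m + 1 → f (m + 1) ≤ f m) (a b : ℤ) (hab : a ≤ b)
    (h : M ≤ a + b) : f b ≤ f a := by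
  have key : ∀ (d : ℕ) (c : ℤ), M ≤ 2 * c + 1 → f (c + d) ≤ f c := by
    intro d
    induction d with
    | zero => intro c _; simp
    | succ d ih =>
      intro c hc
      refine le_trans ?_ (ih c hc)
      have := hm (c + d) (by omega)
      push_cast
      rwa [← add_assoc]
  by_cases hc : M ≤ 2 * a + 1
  · have := key (b - a).toNat a hc
    rwa [Int.toNat_of_nonneg (by omega), add_sub_cancel] at this
  · rw [hs a]
    have := key (b - (M - a)).toNat (M - a) (by omega)
    rwa [Int.toNat_of_nonneg (by omega), add_sub_cancel] at this

theorem convCnt_mono (N k : ℕ) : ∀ m : ℤ, (k : ℤ) * (N + 1) ≤ 2 * m + 1 →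
    convCnt N k (m + 1) ≤ convCnt N k m := by
  induction k with
  | zero =>
    intro m h
    have : m + 1 ≠ 0 := by
      push_cast at h
      omega
    simp [convCnt, this]
  | succ k ih =>
    intro m h
    have h1 := Finset.sum_range_succ (fun j : ℕ => convCnt N k (m - (j : ℤ))) N
    have h2 := Finset.sum_range_succ' (fun j : ℕ => convCnt N k (m - (j : ℤ))) N
    have h3 := le_of_symm_mono (convCnt N k) _ (convCnt_symm N k) ih (m - N) m
      (by omega) (by push_cast at h; linarith)
    simp only [convCnt]
    have e1 : ∀ j : ℕ, m + 1 - 1 - (j : ℤ) = m - j := fun j => by ring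
    have e2 : ∀ j : ℕ, m - ((j + 1 : ℕ) : ℤ) = m - 1 - j := fun j => by push_cast; ring
    simp only [e1]
    simp only [e2] at h2
    simp only [Nat.cast_zero, sub_zero] at h2
    omega

theorem card_eq_convCnt (N k : ℕ) : ∀ m : ℤ,
    ((Fintype.piFinset fun _ : Fin k => Finset.Icc 1 N).filter
      fun a => (∑ i, (a i : ℤ)) = m).card = convCnt N k m := by
  induction k with
  | zero =>
    intro m
    by_cases h : m = 0
    · simp [convCnt, h]
    · simp [convCnt, h, Ne.symm h]
  | succ k ih =>
    intro m
    simp only [convCnt]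
    rw [Finset.card_eq_sum_card_fiberwise (f := fun a => a 0 - 1) (t := Finset.range N)]
    · apply Finset.sum_congr rfl
      intro j hj
      rw [Finset.mem_range] at hj
      rw [← ih]
      apply Finset.card_bij' (fun a _ => Fin.tail a)
        (fun a _ => (Fin.cons (j + 1) a : Fin (k + 1) → ℕ))
      · intro a ha
        simp only [Finset.mem_filter, Fintype.mem_piFinset, Finset.mem_Icc,
          Fin.sum_univ_succ] at ha ⊢
        obtain ⟨⟨h1, h2⟩, h3⟩ := ha
        refine ⟨fun i => h1 i.succ, ?_⟩
        have := h1 0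
        simp only [Fin.tail]
        omega
      · intro a ha
        simp only [Finset.mem_filter, Fintype.mem_piFinset, Finset.mem_Icc,
          Fin.sum_univ_succ, Fin.forall_fin_succ, Fin.cons_zero, Fin.cons_succ] at ha ⊢
        refine ⟨⟨⟨by omega, ha.1⟩, ?_⟩, by omega⟩
        rw [ha.2]; push_cast; ring
      · intro a ha
        simp only [Finset.mem_filter, Fintype.mem_piFinset, Finset.mem_Icc] at ha
        have := ha.1.1 0
        have e : j + 1 = a 0 := by omega
        simp only [e]
        exact Fin.cons_self_tail a
      · intro a ha
        exact Fin.tail_cons _ _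
    · intro a ha
      simp only [Finset.coe_filter, Fintype.mem_piFinset, Finset.mem_Icc, Set.mem_setOf_eq] at ha
      have := ha.1 0
      simp only [Finset.coe_range, Set.mem_Iio]
      omega

/-- the probability mass function of the sum `S` of `n` independent
uniform random variables on `{1,…,n}` is symmetric about its mean `n(n+1)/2`
(the reflection of `m` about `n(n+1)/2` being `n(n+1) − m`), is maximized at the
mean, and is non-increasing to the right of the mean. -/
theorem sum_pmf_symmetric_max_at_mean (n : ℕ) (hn : 0 < n) :
    (∀ m : ℤ, sumProb n m = sumProb n ((n : ℤ) * (n + 1) - m)) ∧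
      (∀ m : ℤ, sumProb n m ≤ sumProb n ((n : ℤ) * (n + 1) / 2)) ∧
      (∀ m : ℤ, (n : ℤ) * (n + 1) / 2 ≤ m → sumProb n (m + 1) ≤ sumProb n m) := by
  have e : ∀ m, sumProb n m = (convCnt n n m : ℝ) / (n : ℝ) ^ n := by
    intro m; rw [sumProb, card_eq_convCnt]
  have hle : ∀ a b, convCnt n n a ≤ convCnt n n b → sumProb n a ≤ sumProb n b := by
    intro a b h
    rw [e, e]
    have : (convCnt n n a : ℝ) ≤ convCnt n n b := by exact_mod_cast h
    gcongr
  have hev : 2 * ((n : ℤ) * (n + 1) / 2) = (n : ℤ) * (n + 1) :=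
    Int.two_mul_ediv_two_of_even (Int.even_mul_succ_self n)
  refine ⟨fun m => ?_, fun m => ?_, fun m hm => ?_⟩
  · rw [e, e, convCnt_symm]
  · apply hle
    have key := le_of_symm_mono (convCnt n n) _ (convCnt_symm n n) (convCnt_mono n n)
      ((n : ℤ) * (n + 1) / 2)
    rcases le_total ((n : ℤ) * (n + 1) / 2) m with h | h
    · exact key m h (by linarith)
    · rw [convCnt_symm n n m]
      exact key _ (by linarith) (by linarith)
  · exact hle _ _ (convCnt_mono n n m (by linarith))
end

section
/- Let (a_1,…,a_n) be chosen uniformly at random from {1,…,n}^n. Then the probability that a_1+…+a_n = n(n+1)/2 is at least n^{−3/2}/4. -/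
open Finset

noncomputable def EE (n k : ℕ) (g : ℤ → ℝ) : ℝ :=
  ∑ a ∈ Fintype.piFinset (fun _ : Fin k => Finset.Icc 1 n), g ((∑ i, a i : ℕ) : ℤ)

lemma EE_zero (n : ℕ) (g : ℤ → ℝ) : EE n 0 g = g 0 := by
  simp [EE]

lemma EE_succ (n k : ℕ) (g : ℤ → ℝ) :
    EE n (k+1) g = ∑ j ∈ Finset.Icc 1 n, EE n k (fun x => g (x + (j : ℤ))) := by
  unfold EE
  rw [← Finset.sum_product']
  refine Finset.sum_nbij' (fun a => (a 0, fun i => a i.succ))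
    (fun p => (Fin.cons p.1 p.2 : Fin (k+1) → ℕ)) ?_ ?_ ?_ ?_ ?_
  · intro a ha
    simp only [Fintype.mem_piFinset, mem_product] at ha ⊢
    exact ⟨ha 0, fun i => ha i.succ⟩
  · rintro ⟨p, q⟩ ha
    simp only [Fintype.mem_piFinset, mem_product] at ha ⊢
    intro i
    refine Fin.cases ?_ (fun i => ?_) i
    · simpa using ha.1
    · simpa using ha.2 i
  · intro a _
    exact Fin.cons_self_tail a
  · rintro ⟨p, q⟩ _
    simp
  · intro a _
    simp only [Fin.sum_univ_succ]
    push_cast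
    rw [add_comm]

lemma EE_add (n k : ℕ) (f g : ℤ → ℝ) :
    EE n k (fun x => f x + g x) = EE n k f + EE n k g := by
  simp [EE, Finset.sum_add_distrib]

lemma EE_mul (n k : ℕ) (c : ℝ) (g : ℤ → ℝ) :
    EE n k (fun x => c * g x) = c * EE n k g := by
  simp [EE, Finset.mul_sum]

lemma EE_const (n k : ℕ) (c : ℝ) : EE n k (fun _ => c) = n ^ k * c := by
  simp [EE]

lemma EE_sum (n k : ℕ) (W : Finset ℤ) (f : ℤ → ℤ → ℝ) :
    EE n k (fun x => ∑ s ∈ W, f s x) = ∑ s ∈ W, EE n k (f s) := by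
  unfold EE
  rw [Finset.sum_comm]

lemma EE_mono (n k : ℕ) (f g : ℤ → ℝ) (h : ∀ x, f x ≤ g x) : EE n k f ≤ EE n k g :=
  Finset.sum_le_sum fun _ _ => h _

noncomputable def ff (n k : ℕ) (s : ℤ) : ℝ := EE n k (fun x => if x = s then 1 else 0)

lemma ff_zero (n : ℕ) (s : ℤ) : ff n 0 s = if 0 = s then 1 else 0 := by
  simp [ff, EE_zero]

lemma ff_succ (n k : ℕ) (s : ℤ) : ff n (k+1) s = ∑ j ∈ Finset.Icc 1 n, ff n k (s - j) := by
  simp only [ff, EE_succ, eq_sub_iff_add_eq]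

lemma sum_refl (n : ℕ) (h : ℤ → ℝ) :
    ∑ j ∈ Finset.Icc 1 n, h (j : ℤ) = ∑ j ∈ Finset.Icc 1 n, h ((n : ℤ) + 1 - j) := by
  refine Finset.sum_nbij' (fun j => n + 1 - j) (fun j => n + 1 - j) ?_ ?_ ?_ ?_ ?_
  · intro j hj; simp only [Finset.mem_Icc] at *; omega
  · intro j hj; simp only [Finset.mem_Icc] at *; omega
  · intro j hj; simp only [Finset.mem_Icc] at *; omega
  · intro j hj; simp only [Finset.mem_Icc] at *; omega
  · intro j hj; simp only [Finset.mem_Icc] at *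
    congr 1; omega

lemma sum_tel (n : ℕ) (h : ℤ → ℝ) (s : ℤ) :
    ∑ j ∈ Finset.Icc 1 n, h (s + 1 - j) - ∑ j ∈ Finset.Icc 1 n, h (s - j) = h s - h (s - n) := by
  induction n with
  | zero => simp
  | succ m ih =>
    rw [Finset.sum_Icc_succ_top (by omega), Finset.sum_Icc_succ_top (by omega)]
    have : s + 1 - ((m + 1 : ℕ) : ℤ) = s - m := by push_cast; ring
    rw [this]
    linarith

lemma ff_symm (n k : ℕ) : ∀ s : ℤ, ff n k (k * (n + 1) - s) = ff n k s := by
  induction k with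
  | zero => intro s; simp [ff_zero, eq_comm]
  | succ k ih =>
    intro s
    rw [ff_succ, ff_succ, sum_refl n (fun j => ff n k (s - j))]
    refine Finset.sum_congr rfl fun j _ => ?_
    rw [← ih]
    congr 1
    push_cast; ring

lemma mono_chain (f : ℤ → ℝ) (c : ℤ) (h : ∀ s, 2 * s + 1 ≤ c → f s ≤ f (s+1))
    (s : ℤ) (d : ℕ) (hd : 2 * (s + d) ≤ c + 1) : f s ≤ f (s + d) := by
  induction d with
  | zero => simp
  | succ d ih =>
    have h1 := ih (by push_cast at hd; omega)
    have h2 := h (s + d) (by push_cast at hd; omega)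
    have : s + ((d + 1 : ℕ) : ℤ) = s + d + 1 := by push_cast; ring
    rw [this]
    linarith

lemma unimodal (f : ℤ → ℝ) (c : ℤ) (hs : ∀ s, f (c - s) = f s)
    (h : ∀ s, 2 * s + 1 ≤ c → f s ≤ f (s+1))
    (s t : ℤ) (hst : |2 * t - c| ≤ |2 * s - c|) : f s ≤ f t := by
  have key : ∀ s t : ℤ, s ≤ t → 2 * t ≤ c → f s ≤ f t := by
    intro s t h1 h2
    obtain ⟨d, rfl⟩ := Int.le.dest h1
    exact mono_chain f c h s d (by omega)
  rcases le_total (2 * t) c with h1 | h1 <;> rcases le_total (2 * s) c with h2 | h2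
  · rw [abs_of_nonpos (by omega), abs_of_nonpos (by omega)] at hst
    exact key _ _ (by omega) h1
  · rw [abs_of_nonpos (by omega), abs_of_nonneg (by omega)] at hst
    rw [← hs s]
    exact key _ _ (by omega) h1
  · rw [abs_of_nonneg (by omega), abs_of_nonpos (by omega)] at hst
    rw [← hs t]
    exact key _ _ (by omega) (by omega)
  · rw [abs_of_nonneg (by omega), abs_of_nonneg (by omega)] at hst
    rw [← hs t, ← hs s]
    exact key _ _ (by omega) (by omega)

lemma ff_step (n k : ℕ) : ∀ s : ℤ, 2 * s + 1 ≤ k * (n + 1) → ff n k s ≤ ff n k (s + 1) := by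
  induction k with
  | zero =>
    intro s h
    have : s ≠ 0 := by rintro rfl; simp at h
    rw [ff_zero, if_neg this.symm, ff_zero]
    split_ifs <;> norm_num
  | succ k ih =>
    intro s h
    have h1 := sum_tel n (ff n k) s
    rw [ff_succ, ff_succ]
    have h2 : ff n k (s - n) ≤ ff n k s := by
      refine unimodal _ (k * (n+1)) (ff_symm n k) ih _ _ ?_
      have h3 : 2 * s + 1 ≤ (k:ℤ) * (n + 1) + n + 1 := by push_cast at h; linarith
      generalize (k:ℤ) * (n + 1) = c at *
      rw [abs_le]
      have := neg_le_abs (2 * (s - (n:ℤ)) - c)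
      have := le_abs_self (2 * (s - (n:ℤ)) - c)
      constructor <;> omega
    linarith

lemma S1 (n : ℕ) : ∑ j ∈ Finset.Icc 1 n, (2 * (j:ℝ) - (n + 1)) = 0 := by
  have h := sum_refl n (fun j => 2 * (j:ℝ) - (n + 1))
  have h2 : ∑ j ∈ Finset.Icc 1 n, (2 * (((n : ℤ) + 1 - (j:ℤ) : ℤ):ℝ) - (n + 1))
      = - ∑ j ∈ Finset.Icc 1 n, (2 * (j:ℝ) - (n + 1)) := by
    rw [← Finset.sum_neg_distrib]
    refine Finset.sum_congr rfl fun j _ => ?_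
    push_cast; ring
  simp only [Int.cast_natCast] at h
  rw [h2] at h
  linarith

lemma S2aux (n : ℕ) (x : ℝ) : ∑ j ∈ Finset.Icc 1 n, (2 * (j:ℝ) - x)^2
    = 2 * n * (n+1) * (2*n+1) / 3 - 2 * x * n * (n+1) + n * x^2 := by
  induction n with
  | zero => simp
  | succ m ih =>
    rw [Finset.sum_Icc_succ_top (by omega), ih]
    push_cast; ring

lemma S2 (n : ℕ) : ∑ j ∈ Finset.Icc 1 n, (2 * (j:ℝ) - (n + 1))^2 = (n:ℝ) * ((n:ℝ)^2 - 1) / 3 := by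
  rw [S2aux]; ring

lemma VV (n k : ℕ) : EE n k (fun x => (2 * (x:ℝ) - k * (n + 1))^2)
    = k * n ^ k * ((n^2 - 1) / 3) := by
  induction k with
  | zero => simp [EE_zero]
  | succ k ih =>
    rw [EE_succ]
    have : ∀ j : ℕ, EE n k (fun x => (2 * ((x + (j:ℤ) : ℤ):ℝ) - (k+1:ℕ) * (n + 1))^2)
        = EE n k (fun x => (2 * (x:ℝ) - k * (n + 1))^2)
          + (2 * EE n k (fun x => (2 * (x:ℝ) - k * (n + 1)))) * (2 * (j:ℝ) - (n+1))
          + n ^ k * (2 * (j:ℝ) - (n+1))^2 := by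
      intro j
      rw [← EE_const, mul_assoc, mul_comm (EE n k _), ← mul_assoc, ← EE_mul, ← EE_add, ← EE_add]
      congr 1
      ext x
      push_cast; ring
    simp only [this, Finset.sum_add_distrib, ← Finset.mul_sum, S1, S2, ih]
    simp
    ring

lemma main_bound (n : ℕ) (hn : 0 < n) (R : ℝ) (hR : 1 ≤ R) (hR2 : R^2 = (n:ℝ)^3)
    (M : ℤ) (hM : 2 * M = n * (n+1)) : (n:ℝ)^n ≤ 4 * R * ff n n M := by
  have hn0 : (0:ℝ) < n := by exact_mod_cast hn
  set m : ℕ := ⌊R / 2⌋₊ with hm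
  have hm1 : (m:ℝ) ≤ R / 2 := Nat.floor_le (by linarith)
  have hm2 : R / 2 < m + 1 := Nat.lt_floor_add_one _
  have hMr : 2 * (M:ℝ) = n * (n+1) := by exact_mod_cast hM
  have h1 : EE n n (fun _ => 1) ≤ EE n n (fun x =>
      (∑ s ∈ Finset.Icc (M - m) (M + m), if x = s then 1 else 0)
        + (1 / (n:ℝ)^3) * (2 * (x:ℝ) - n * (n + 1))^2) := by
    refine EE_mono _ _ _ _ fun x => ?_
    rw [Finset.sum_ite_eq]
    split_ifs with hx
    · have : 0 ≤ (1 / (n:ℝ)^3) * (2 * (x:ℝ) - n * (n + 1))^2 := by positivity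
      linarith
    · rw [← hMr, ← hR2, zero_add, one_div, ← div_eq_inv_mul, le_div_iff₀ (by positivity), one_mul]
      rw [sq_le_sq, abs_of_nonneg (by linarith : 0 ≤ R)]
      simp only [Finset.mem_Icc, not_and_or, not_le] at hx
      rcases hx with hx | hx
      · have : (x:ℝ) + 1 ≤ M - m := by exact_mod_cast (by omega : x + 1 ≤ M - m)
        refine le_trans ?_ (neg_le_abs _)
        linarith
      · have : (M:ℝ) + m + 1 ≤ x := by exact_mod_cast (by omega : M + m + 1 ≤ x)
        refine le_trans ?_ (le_abs_self _)
        linarith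
  rw [EE_add, EE_sum, EE_mul, VV, EE_const, mul_one] at h1
  have h2 : ∑ s ∈ Finset.Icc (M - m) (M + m), EE n n (fun x => if x = s then 1 else 0)
      ≤ (2 * m + 1) * ff n n M := by
    have := Finset.sum_le_card_nsmul (Finset.Icc (M - (m:ℤ)) (M + m)) (fun s => ff n n s) (ff n n M)
      (fun s _ => unimodal _ (n * (n+1)) (ff_symm n n) (ff_step n n) _ _ (by
        rw [hM]; simp))
    have hc : (Finset.Icc (M - (m:ℤ)) (M + m)).card = 2 * m + 1 := by
      rw [Int.card_Icc]; omega
    rw [hc, nsmul_eq_mul] at this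
    push_cast at this
    exact this
  have h3 : 1 / (n:ℝ)^3 * (n * n ^ n * ((n^2-1)/3)) ≤ n ^ n / 3 := by
    rw [one_div, ← div_eq_inv_mul, div_le_iff₀ (by positivity)]
    have : (0:ℝ) ≤ n * n ^ n := by positivity
    nlinarith
  have hf : 0 ≤ ff n n M := by
    unfold ff EE
    exact Finset.sum_nonneg fun _ _ => by beta_reduce; split_ifs <;> norm_num
  have h4 : (2 * m + 1) * ff n n M ≤ (2 * R) * ff n n M :=
    mul_le_mul_of_nonneg_right (by linarith) hf
  have h5 : 0 ≤ R * ff n n M := by positivity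
  linarith

/-- if (a_1,…,a_n) is chosen uniformly from {1,…,n}^n, then the
probability that a_1+…+a_n = n(n+1)/2 is at least n^{-3/2}/4. -/
theorem prob_sum_eq_mean_ge (n : ℕ) (hn : 0 < n) :
    (n : ℝ) ^ (-(3 : ℝ) / 2) / 4 ≤
      (((Fintype.piFinset fun _ : Fin n => Finset.Icc 1 n).filter
          fun a => ∑ i, a i = n * (n + 1) / 2).card : ℝ) / (n : ℝ) ^ n := by
  have hn0 : (0:ℝ) < n := by exact_mod_cast hn
  have hcard : (((Fintype.piFinset fun _ : Fin n => Finset.Icc 1 n).filter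
          fun a => ∑ i, a i = n * (n + 1) / 2).card : ℝ) = ff n n ((n * (n+1) / 2 : ℕ) : ℤ) := by
    unfold ff EE
    simp only [Nat.cast_inj, Finset.sum_boole]
  have hM : 2 * ((n * (n+1) / 2 : ℕ) : ℤ) = n * (n+1) := by
    have := Nat.two_mul_div_two_of_even (Nat.even_mul_succ_self n)
    exact_mod_cast this
  have hR2 : ((n:ℝ) ^ ((3:ℝ)/2))^2 = (n:ℝ)^3 := by
    rw [← Real.rpow_natCast, ← Real.rpow_mul hn0.le]
    norm_num
  have hR : 1 ≤ (n:ℝ) ^ ((3:ℝ)/2) :=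
    Real.one_le_rpow (by exact_mod_cast hn) (by norm_num)
  have h := main_bound n hn _ hR hR2 _ hM
  rw [hcard, neg_div, Real.rpow_neg hn0.le, le_div_iff₀ (by positivity)]
  have hp : 0 < (n:ℝ) ^ ((3:ℝ)/2) := by positivity
  generalize (n:ℝ) ^ ((3:ℝ)/2) = R at *
  rw [div_mul_eq_mul_div, ← div_eq_inv_mul, div_div, div_le_iff₀ (by positivity)]
  linarith
end

section
/- Let A be a uniformly random n-sided die in the balanced sequences model. Then with probability at least 1 − 8n^{−11/2}, one has max_{1 ≤ j ≤ n} |g_A(j)| ≤ 2·√(n·log n). -/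
open Finset

open MeasureTheory ProbabilityTheory in
lemma die_mgf (n : ℕ) (hn : 0 < n) (h : ℕ → ℝ) (h0 : ∀ a, 0 ≤ h a ∧ h a ≤ 1)
    (m : ℝ) (hm : ∑ a ∈ Finset.Icc 1 n, h a = n * m) (l : ℝ) :
    ∑ a ∈ Finset.Icc 1 n, Real.exp (l * (h a - m)) ≤ n * Real.exp (l ^ 2 / 8) := by
  have hn' : (n : ℝ) ≠ 0 := by positivity
  let μ : Measure ℕ := ((n : ENNReal)⁻¹) • ∑ a ∈ Finset.Icc 1 n, Measure.dirac a
  have hint : ∀ f : ℕ → ℝ, ∫ x, f x ∂μ = (n : ℝ)⁻¹ * ∑ a ∈ Finset.Icc 1 n, f a := by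
    intro f
    simp only [μ]
    rw [integral_smul_measure, integral_finsetSum_measure]
    · simp
    · intro i _
      exact integrable_dirac (by simp)
  have : IsProbabilityMeasure μ := ⟨by
    simp [μ]
    exact ENNReal.inv_mul_cancel (by simpa using hn.ne') (by simp)⟩
  have hs := hasSubgaussianMGF_of_mem_Icc (μ := μ) (X := h) (a := 0) (b := 1)
    (Measurable.of_discrete).aemeasurable (Filter.Eventually.of_forall fun a => h0 a)
  have h2 := hs.mgf_le l
  rw [mgf, hint, hint, hm] at h2
  rw [inv_mul_cancel_left₀ hn', inv_mul_le_iff₀ (by positivity)] at h2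
  refine h2.trans (le_of_eq ?_)
  congr 2
  simp
  ring

lemma die_hoeff (n : ℕ) (hn : 0 < n) (h : ℕ → ℝ) (h0 : ∀ a, 0 ≤ h a ∧ h a ≤ 1)
    (m : ℝ) (hm : ∑ a ∈ Finset.Icc 1 n, h a = n * m) (t : ℝ) (ht : 0 ≤ t) :
    (((Fintype.piFinset fun _ : Fin n => Finset.Icc 1 n).filter
      fun A => t ≤ ∑ i, (h (A i) - m)).card : ℝ) ≤ (n : ℝ) ^ n * Real.exp (- (2 * t ^ 2 / n)) := by
  have hn' : (0 : ℝ) < n := by positivity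
  set l : ℝ := 4 * t / n with hl
  have hl0 : 0 ≤ l := by positivity
  have h1 : ∑ A ∈ Fintype.piFinset (fun _ : Fin n => Finset.Icc 1 n),
      Real.exp (l * ∑ i, (h (A i) - m)) ≤ (n * Real.exp (l ^ 2 / 8)) ^ n := by
    refine le_trans (le_of_eq ?_) (pow_le_pow_left₀ (Finset.sum_nonneg fun _ _ => (Real.exp_pos _).le)
      (die_mgf n hn h h0 m hm l) n)
    rw [Finset.sum_pow']
    refine Finset.sum_congr rfl fun A _ => ?_
    rw [Finset.mul_sum, Real.exp_sum]
  have h2 : (((Fintype.piFinset fun _ : Fin n => Finset.Icc 1 n).filter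
      fun A => t ≤ ∑ i, (h (A i) - m)).card : ℝ) * Real.exp (l * t) ≤
      ∑ A ∈ Fintype.piFinset (fun _ : Fin n => Finset.Icc 1 n),
      Real.exp (l * ∑ i, (h (A i) - m)) := by
    generalize Fintype.piFinset (fun _ : Fin n => Finset.Icc 1 n) = T
    have q1 : ∑ A ∈ T.filter (fun A => t ≤ ∑ i, (h (A i) - m)), Real.exp (l * t) ≤
        ∑ A ∈ T.filter (fun A => t ≤ ∑ i, (h (A i) - m)), Real.exp (l * ∑ i, (h (A i) - m)) := by
      apply Finset.sum_le_sum
      intro A hA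
      have := (Finset.mem_filter.1 hA).2
      exact Real.exp_le_exp.2 (mul_le_mul_of_nonneg_left this hl0)
    have q2 : ∑ A ∈ T.filter (fun A => t ≤ ∑ i, (h (A i) - m)), Real.exp (l * ∑ i, (h (A i) - m)) ≤
        ∑ A ∈ T, Real.exp (l * ∑ i, (h (A i) - m)) := by
      apply Finset.sum_le_sum_of_subset_of_nonneg
      · exact Finset.filter_subset _ _
      · intros
        positivity
    rw [Finset.sum_const, nsmul_eq_mul] at q1
    exact q1.trans q2
  have h3 := h2.trans h1
  rw [← le_div_iff₀ (Real.exp_pos _), mul_pow, ← Real.exp_nat_mul, mul_div_assoc, ← Real.exp_sub] at h3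
  refine h3.trans (le_of_eq ?_)
  congr 2
  rw [hl]
  field_simp
  ring

lemma die_hoeff2 (n : ℕ) (hn : 0 < n) (h : ℕ → ℝ) (h0 : ∀ a, 0 ≤ h a ∧ h a ≤ 1)
    (m : ℝ) (hm : ∑ a ∈ Finset.Icc 1 n, h a = n * m) (t : ℝ) (ht : 0 ≤ t) :
    (((Fintype.piFinset fun _ : Fin n => Finset.Icc 1 n).filter
      fun A => t ≤ |∑ i, (h (A i) - m)|).card : ℝ) ≤
        2 * ((n : ℝ) ^ n * Real.exp (- (2 * t ^ 2 / n))) := by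
  have a1 := die_hoeff n hn h h0 m hm t ht
  have a2 := die_hoeff n hn (fun a => 1 - h a) (fun a => ⟨by linarith [(h0 a).2], by linarith [(h0 a).1]⟩)
    (1 - m) (by rw [Finset.sum_sub_distrib, hm]; simp; ring) t ht
  have e : ∀ A : Fin n → ℕ, ∑ i, ((1 - h (A i)) - (1 - m)) = - ∑ i, (h (A i) - m) := by
    intro A
    rw [← Finset.sum_neg_distrib]
    exact Finset.sum_congr rfl fun i _ => by ring
  simp only [e] at a2
  simp only [le_abs]
  rw [Finset.filter_or]
  have := Finset.card_union_le ((Fintype.piFinset fun _ : Fin n => Finset.Icc 1 n).filter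
      fun A => t ≤ ∑ i, (h (A i) - m)) ((Fintype.piFinset fun _ : Fin n => Finset.Icc 1 n).filter
      fun A => t ≤ - ∑ i, (h (A i) - m))
  have := (Nat.cast_le (α := ℝ)).2 this
  push_cast at this
  linarith

def dieCnt (n m : ℕ) (s : ℤ) : ℕ :=
  ((Fintype.piFinset fun _ : Fin m => Finset.Icc 1 n).filter
    fun A => ∑ i, (A i : ℤ) = s).card

lemma dieCnt_succ (n m : ℕ) (s : ℤ) :
    dieCnt n (m + 1) s = ∑ a ∈ Finset.Icc 1 n, dieCnt n m (s - a) := by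
  unfold dieCnt
  rw [← Finset.card_sigma]
  refine Finset.card_bij' (fun A _ => ⟨A 0, Fin.tail A⟩) (fun p _ => Fin.cons p.1 p.2) ?_ ?_ ?_ ?_
  · intro A hA
    simp only [Finset.mem_filter, Fintype.mem_piFinset, Finset.mem_sigma, Fin.sum_univ_succ] at hA ⊢
    refine ⟨hA.1 0, fun i => hA.1 i.succ, ?_⟩
    simp only [Fin.tail]
    linarith [hA.2]
  · rintro ⟨a, A⟩ hA
    simp only [Finset.mem_filter, Fintype.mem_piFinset, Finset.mem_sigma, Fin.sum_univ_succ] at hA ⊢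
    refine ⟨fun i => ?_, by simp [hA.2.2]⟩
    refine Fin.cases ?_ (fun i => ?_) i
    · simpa using hA.1
    · simpa using hA.2.1 i
  · intro A _; simp
  · rintro ⟨a, A⟩ _; simp

lemma dieCnt_step (n m : ℕ) (s : ℤ) :
    dieCnt n (m + 1) (s + 1) + dieCnt n m (s - n) = dieCnt n (m + 1) s + dieCnt n m s := by
  rw [dieCnt_succ, dieCnt_succ]
  have h1 : ∀ k : ℕ, ∑ a ∈ Finset.Icc 1 k, dieCnt n m (s + 1 - a) + dieCnt n m (s - k) =
      ∑ a ∈ Finset.Icc 1 k, dieCnt n m (s - a) + dieCnt n m s := by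
    intro k
    induction k with
    | zero => simp
    | succ k ih =>
      rw [Finset.sum_Icc_succ_top (by omega), Finset.sum_Icc_succ_top (by omega)]
      have : s + 1 - ((k + 1 : ℕ) : ℤ) = s - k := by push_cast; ring
      rw [this]
      omega
  exact h1 n

lemma dieCnt_symm (n m : ℕ) (s : ℤ) : dieCnt n m (m * (n + 1) - s) = dieCnt n m s := by
  induction m generalizing s with
  | zero =>
    simp [dieCnt, eq_comm]
  | succ m ih =>
    rw [dieCnt_succ, dieCnt_succ]
    refine Finset.sum_bij' (fun a _ => n + 1 - a) (fun a _ => n + 1 - a) ?_ ?_ ?_ ?_ ?_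
    · intro a ha; simp only [Finset.mem_Icc] at *; omega
    · intro a ha; simp only [Finset.mem_Icc] at *; omega
    · intro a ha; simp only [Finset.mem_Icc] at *; omega
    · intro a ha; simp only [Finset.mem_Icc] at *; omega
    · intro a ha
      simp only [Finset.mem_Icc] at ha
      rw [← ih (s - ((n + 1 - a : ℕ) : ℤ))]
      congr 1
      rw [Nat.cast_sub (by omega)]
      push_cast
      ring

lemma dieCnt_unimodal (n m : ℕ) (s t : ℤ)
    (h : |2 * s - m * (n + 1)| ≤ |2 * t - m * (n + 1)|) : dieCnt n m t ≤ dieCnt n m s := by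
  induction m generalizing s t with
  | zero =>
    by_cases ht : t = 0
    · subst ht
      have : s = 0 := by
        have h' : 2 * |s| ≤ 0 := by simpa using h
        exact abs_eq_zero.1 (le_antisymm (by linarith) (abs_nonneg _))
      rw [this]
    · have : dieCnt n 0 t = 0 := by
        simp [dieCnt, Ne.symm ht]
      omega
  | succ m ih =>
    -- monotone below the centre
    have up : ∀ s : ℤ, 2 * s + 1 ≤ ((m + 1 : ℕ) : ℤ) * (n + 1) →
        dieCnt n (m + 1) s ≤ dieCnt n (m + 1) (s + 1) := by
      intro s hs
      have h1 := dieCnt_step n m s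
      have h2 := ih s (s - n) (by
        push_cast at hs
        have e : ((m : ℤ) + 1) * (n + 1) = m * (n + 1) + n + 1 := by ring
        generalize (m : ℤ) * (n + 1) = c at *
        have hnn : (0 : ℤ) ≤ n := by positivity
        rw [← sq_le_sq]
        nlinarith)
      omega
    have up' : ∀ k : ℕ, ∀ s : ℤ, 2 * (s + k) ≤ ((m + 1 : ℕ) : ℤ) * (n + 1) →
        dieCnt n (m + 1) s ≤ dieCnt n (m + 1) (s + k) := by
      intro k
      induction k with
      | zero => intro s _; simp
      | succ k ihk =>
        intro s hs
        have a1 := ihk s (by push_cast at hs ⊢; linarith)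
        have a2 := up (s + k) (by push_cast at hs ⊢; linarith)
        have : s + ((k + 1 : ℕ) : ℤ) = s + k + 1 := by push_cast; ring
        rw [this]
        exact a1.trans a2
    have key : ∀ s : ℤ, ∃ s', 2 * s' ≤ ((m + 1 : ℕ) : ℤ) * (n + 1) ∧
        dieCnt n (m + 1) s' = dieCnt n (m + 1) s ∧
        |2 * s - ((m + 1 : ℕ) : ℤ) * (n + 1)| = ((m + 1 : ℕ) : ℤ) * (n + 1) - 2 * s' := by
      intro s
      rcases le_total (2 * s) (((m + 1 : ℕ) : ℤ) * (n + 1)) with h | h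
      · exact ⟨s, h, rfl, by rw [abs_of_nonpos (by linarith)]; ring⟩
      · exact ⟨_, by linarith, dieCnt_symm n (m + 1) s, by rw [abs_of_nonneg (by linarith)]; ring⟩
    obtain ⟨s', b1, b2, b3⟩ := key s
    obtain ⟨t', c1, c2, c3⟩ := key t
    rw [b3, c3] at h
    rw [← b2, ← c2]
    obtain ⟨k, hk⟩ := Int.le.dest (show t' ≤ s' by linarith)
    rw [← hk]
    exact up' k t' (by rw [hk]; exact b1)

lemma sum_Icc_cast (n : ℕ) : ∑ a ∈ Finset.Icc 1 n, (a : ℝ) = n * (n + 1) / 2 := by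
  induction n with
  | zero => simp
  | succ k ih =>
    rw [Finset.sum_Icc_succ_top (by omega), ih]; push_cast; ring

lemma dieCnt_eq (n : ℕ) : (dieFinset n).card = dieCnt n n ((n * (n + 1) / 2 : ℕ) : ℤ) := by
  unfold dieFinset dieCnt
  congr 1
  apply Finset.filter_congr
  intro A _
  rw [← Nat.cast_sum, Nat.cast_inj]

lemma die_lower (n : ℕ) (hn : 2 ≤ n) :
    (n : ℝ) ^ n ≤ 4 * (n * Real.sqrt n) * (dieFinset n).card := by
  have hn2 : (2 : ℝ) ≤ n := by exact_mod_cast hn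
  have hn0 : (0 : ℝ) < n := by linarith
  set r : ℝ := n * Real.sqrt n with hr
  have hs : 0 < Real.sqrt n := Real.sqrt_pos.2 hn0
  have hsq : Real.sqrt n ^ 2 = n := Real.sq_sqrt hn0.le
  have hs1 : (1.4 : ℝ) ≤ Real.sqrt n := Real.le_sqrt_of_sq_le (by norm_num; linarith)
  have hr2 : (2.8 : ℝ) ≤ r := by nlinarith
  set M : ℕ := n * (n + 1) / 2 with hM
  have hM2 : 2 * M = n * (n + 1) := Nat.mul_div_cancel' (Nat.even_mul_succ_self n).two_dvd
  have hMr : (M : ℝ) = n * (n + 1) / 2 := by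
    have : (2 : ℝ) * M = n * (n + 1) := by exact_mod_cast hM2
    linarith
  have hmin : ∀ a ∈ Finset.Icc 1 n, min ((a : ℝ) / n) 1 = a / n := by
    intro a ha
    rw [min_eq_left]
    rw [div_le_one hn0]
    exact_mod_cast (Finset.mem_Icc.1 ha).2
  have hH := die_hoeff2 n (by omega) (fun a => min ((a : ℝ) / n) 1)
    (fun a => ⟨le_min (by positivity) zero_le_one, min_le_right _ _⟩) ((n + 1) / (2 * n))
    (by
      rw [Finset.sum_congr rfl hmin, ← Finset.sum_div, sum_Icc_cast]
      field_simp) (Real.sqrt n) hs.le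
  rw [hsq, mul_div_assoc, div_self hn0.ne', mul_one] at hH
  set T := Fintype.piFinset fun _ : Fin n => Finset.Icc 1 n with hT
  have hcard : (T.card : ℝ) = (n : ℝ) ^ n := by
    rw [hT, Fintype.card_piFinset_const]; simp
  have hval : ∀ A ∈ T, ∑ i, (min ((A i : ℝ) / n) 1 - (n + 1) / (2 * n)) =
      ((∑ i, (A i : ℝ)) - M) / n := by
    intro A hA
    rw [Finset.sum_sub_distrib, Finset.sum_congr rfl
      (fun i _ => hmin (A i) (Fintype.mem_piFinset.1 hA i)), ← Finset.sum_div, hMr]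
    simp
    field_simp
  set B := T.filter fun A => Real.sqrt n ≤ |∑ i, (min ((A i : ℝ) / n) 1 - (n + 1) / (2 * n))|
  set k : ℕ := ⌊r⌋₊
  have hgood : (T \ B).card ≤ (2 * k + 1) * (dieFinset n).card := by
    have hcI : (Finset.Icc ((M : ℤ) - k) (M + k)).card = 2 * k + 1 := by
      rw [Int.card_Icc]; omega
    rw [← hcI, mul_comm]
    refine Finset.card_le_mul_card_image_of_maps_to (f := fun A : Fin n → ℕ => ∑ i, (A i : ℤ)) ?_ _ ?_
    · intro A hA
      have hAT := (Finset.mem_sdiff.1 hA).1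
      have hAB : ¬ (Real.sqrt n ≤ |∑ i, (min ((A i : ℝ) / n) 1 - (n + 1) / (2 * n))|) :=
        fun h => (Finset.mem_sdiff.1 hA).2 (Finset.mem_filter.2 ⟨hAT, h⟩)
      rw [hval A hAT, abs_div, abs_of_pos hn0, not_le, div_lt_iff₀ hn0] at hAB
      have h1 : ((|∑ i, (A i : ℤ) - M| : ℤ) : ℝ) < r := by
        push_cast
        rw [hr, mul_comm]; exact hAB
      have h2 : (|∑ i, (A i : ℤ) - M|).toNat ≤ k := by
        apply Nat.le_floor
        refine le_trans (le_of_eq ?_) h1.le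
        have := Int.toNat_of_nonneg (abs_nonneg (∑ i, (A i : ℤ) - M))
        exact_mod_cast this
      have h3 : |∑ i, (A i : ℤ) - M| ≤ k := by omega
      rw [abs_le] at h3
      simp only [Finset.mem_Icc]
      constructor <;> linarith [h3.1, h3.2]
    · intro s _
      refine le_trans (Finset.card_le_card (Finset.filter_subset_filter _ Finset.sdiff_subset)) ?_
      rw [dieCnt_eq]
      apply dieCnt_unimodal n n _ s
      have : 2 * ((M : ℕ) : ℤ) - n * (n + 1) = 0 := by
        have : (2 : ℤ) * M = n * (n + 1) := by exact_mod_cast hM2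
        linarith
      rw [← hM, this, abs_zero]
      exact abs_nonneg _
  have hTle : T.card ≤ (T \ B).card + B.card := by
    rw [Finset.card_sdiff_add_card_eq_card (Finset.filter_subset _ _)]
  have g1 : ((T \ B).card : ℝ) ≤ (2 * k + 1) * (dieFinset n).card := by exact_mod_cast hgood
  have g2 : (T.card : ℝ) ≤ (T \ B).card + B.card := by exact_mod_cast hTle
  have hk : (k : ℝ) ≤ r := Nat.floor_le (by linarith)
  have he : Real.exp (-2) ≤ 1 / 7 := by
    have h1 := Real.exp_one_gt_d9
    have h2 : Real.exp (-2) * Real.exp 1 * Real.exp 1 = 1 := by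
      rw [← Real.exp_add, ← Real.exp_add]; norm_num
    have h3 := Real.exp_pos (-2)
    have h4 : (7 : ℝ) ≤ Real.exp 1 * Real.exp 1 := by nlinarith
    nlinarith
  rw [hcard] at g2
  have hN : (0 : ℝ) < (n : ℝ) ^ n := by positivity
  have hD : (0 : ℝ) ≤ (dieFinset n).card := by positivity
  have g3 : (B.card : ℝ) ≤ 2 * ((n : ℝ) ^ n * (1 / 7)) := hH.trans (by gcongr)
  have g4 : (2 * k + 1) * ((dieFinset n).card : ℝ) ≤ (2.4 * r) * (dieFinset n).card := by
    gcongr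
    linarith
  have g5 : 0 ≤ r * ((dieFinset n).card : ℝ) := by positivity
  nlinarith

lemma die_bad_j (n : ℕ) (hn : 0 < n) (j : ℕ) (hj : j ∈ Finset.Icc 1 n) :
    (((Fintype.piFinset fun _ : Fin n => Finset.Icc 1 n).filter
      fun A => 2 * Real.sqrt (n * Real.log n) ≤ |gA A j|).card : ℝ) ≤
        2 * ((n : ℝ) ^ n * ((n : ℝ) ^ 8)⁻¹) := by
  have hn0 : (0 : ℝ) < n := by positivity
  have hn1 : (1 : ℝ) ≤ n := by exact_mod_cast hn
  have hj' := Finset.mem_Icc.1 hj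
  let h : ℕ → ℝ := fun a => (if a < j then 1 else 0) + (1 / 2) * (if a = j then 1 else 0)
  have h0 : ∀ a, 0 ≤ h a ∧ h a ≤ 1 := by
    intro a
    simp only [h]
    rcases lt_trichotomy a j with hh | hh | hh
    · simp [hh, hh.ne]
    · simp [hh]; norm_num
    · simp [hh.not_gt, hh.ne']
  have hsum : ∑ a ∈ Finset.Icc 1 n, h a = n * (((j : ℝ) - 1 / 2) / n) := by
    rw [mul_div_cancel₀ _ hn0.ne']
    simp only [h]
    rw [Finset.sum_add_distrib, ← Finset.mul_sum, Finset.sum_ite_eq', if_pos hj, Finset.sum_boole]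
    have : (Finset.Icc 1 n).filter (fun a => a < j) = Finset.Ico 1 j := by
      ext a; simp only [Finset.mem_filter, Finset.mem_Icc, Finset.mem_Ico]; omega
    rw [this, Nat.card_Ico, Nat.cast_sub hj'.1]
    push_cast; ring
  have hg : ∀ A : Fin n → ℕ, gA A j = ∑ i, (h (A i) - ((j : ℝ) - 1 / 2) / n) := by
    intro A
    simp only [gA, fA, h]
    rw [Finset.sum_sub_distrib, Finset.sum_add_distrib, ← Finset.mul_sum, Finset.sum_boole,
      Finset.sum_boole]
    simp only [Finset.sum_const, Finset.card_univ, Fintype.card_fin, nsmul_eq_mul]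
    rw [mul_div_cancel₀ _ hn0.ne']
    ring
  have hlog : 0 ≤ Real.log n := Real.log_nonneg hn1
  have := die_hoeff2 n hn h h0 _ hsum (2 * Real.sqrt (n * Real.log n)) (by positivity)
  simp only [← hg] at this
  refine this.trans (le_of_eq ?_)
  congr 2
  rw [Real.exp_neg]
  congr 1
  rw [mul_pow, Real.sq_sqrt (by positivity)]
  have : 2 * (2 ^ 2 * (n * Real.log n)) / (n : ℝ) = (8 : ℕ) * Real.log n := by
    field_simp; push_cast; ring
  rw [this, Real.exp_nat_mul, Real.exp_log hn0]

open scoped Classical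

/-- for a uniformly random n-sided die A (balanced sequences model),
with probability at least 1 − 8·n^{−11/2} we have max_j |g_A(j)| ≤ 2√(n·log n). -/
theorem gA_max_bound_whp (n : ℕ) (hn : 0 < n) :
    1 - 8 * (n : ℝ) ^ (-(11 : ℝ) / 2) ≤
      (((dieFinset n).filter fun A =>
          ∀ j ∈ Finset.Icc 1 n, |gA A j| ≤ 2 * Real.sqrt (n * Real.log n)).card : ℝ) /
        (dieFinset n).card := by
  rcases Nat.lt_or_ge n 2 with h2 | h2
  · have : n = 1 := by omega
    subst this
    refine le_trans ?_ (div_nonneg (Nat.cast_nonneg _) (Nat.cast_nonneg _))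
    norm_num
  have hn0 : (0 : ℝ) < n := by positivity
  have hs : 0 < Real.sqrt n := Real.sqrt_pos.2 hn0
  have hL := die_lower n h2
  have hD : (0 : ℝ) < (dieFinset n).card := by
    have : 0 < (n : ℝ) ^ n := by positivity
    have h4 : 0 < 4 * (n * Real.sqrt n) := by positivity
    exact pos_of_mul_pos_right (this.trans_le hL) h4.le
  rw [le_div_iff₀ hD]
  set G := (dieFinset n).filter fun A =>
          ∀ j ∈ Finset.Icc 1 n, |gA A j| ≤ 2 * Real.sqrt (n * Real.log n) with hG
  let Bj : ℕ → Finset (Fin n → ℕ) := fun j => (Fintype.piFinset fun _ : Fin n => Finset.Icc 1 n).filter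
      fun A => 2 * Real.sqrt (n * Real.log n) ≤ |gA A j|
  have hsub : dieFinset n ⊆ G ∪ (Finset.Icc 1 n).biUnion Bj := by
    intro A hA
    by_cases hAG : A ∈ G
    · exact Finset.mem_union_left _ hAG
    · apply Finset.mem_union_right
      have : ¬ ∀ j ∈ Finset.Icc 1 n, |gA A j| ≤ 2 * Real.sqrt (n * Real.log n) :=
        fun h => hAG (by rw [hG]; simp only [Finset.mem_filter]; exact ⟨hA, h⟩)
      push Not at this
      obtain ⟨j, hj, hlt⟩ := this
      exact Finset.mem_biUnion.2 ⟨j, hj, Finset.mem_filter.2 ⟨(Finset.mem_filter.1 hA).1, hlt.le⟩⟩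
  have hc : ((dieFinset n).card : ℝ) ≤ G.card + ∑ j ∈ Finset.Icc 1 n, ((Bj j).card : ℝ) := by
    have := (Finset.card_le_card hsub).trans (Finset.card_union_le _ _)
    have h3 := this.trans (Nat.add_le_add_left (Finset.card_biUnion_le) _)
    exact_mod_cast h3
  have hb : ∑ j ∈ Finset.Icc 1 n, ((Bj j).card : ℝ) ≤ n * (2 * ((n : ℝ) ^ n * ((n : ℝ) ^ 8)⁻¹)) := by
    refine le_trans (Finset.sum_le_sum (g := fun _ => 2 * ((n : ℝ) ^ n * ((n : ℝ) ^ 8)⁻¹)) ?_) ?_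
    · intro j hj
      convert die_bad_j n hn j hj
    · simp
  have hpow : (n : ℝ) ^ (-(11 : ℝ) / 2) = n * (n * Real.sqrt n) * ((n : ℝ) ^ 8)⁻¹ := by
    have e1 : (n : ℝ) ^ (-(11 : ℝ) / 2) = Real.sqrt n * ((n : ℝ) ^ 6)⁻¹ := by
      rw [Real.sqrt_eq_rpow, ← Real.rpow_natCast, ← Real.rpow_neg hn0.le, ← Real.rpow_add hn0]
      norm_num
    rw [e1]
    field_simp
  have hfin : n * (2 * ((n : ℝ) ^ n * ((n : ℝ) ^ 8)⁻¹)) ≤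
      8 * (n : ℝ) ^ (-(11 : ℝ) / 2) * (dieFinset n).card := by
    have hpos : 0 ≤ 2 * n * ((n : ℝ) ^ 8)⁻¹ := by positivity
    have := mul_le_mul_of_nonneg_left hL hpos
    rw [hpow]
    calc _ = 2 * n * ((n : ℝ) ^ 8)⁻¹ * (n : ℝ) ^ n := by ring
      _ ≤ _ := this
      _ = _ := by ring
  nlinarith
end

section
/- Let Y_0,…,Y_n be real random variables adapted to a filtration F_0 ⊆ … ⊆ F_n (each Y_i is F_i-measurable), with |Y_{i+1} − Y_i| ≤ 1 almost surely. For 1 ≤ i ≤ n let D_i be the event that the conditional expectation E[Y_i − Y_{i−1} | F_{i−1}] is negative. Then for every ε > 0, P[Y_n ≤ Y_0 − ε] ≤ exp(−ε²/(2n)) + P[D_1 ∪ … ∪ D_n]. -/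
open MeasureTheory

lemma exp_le_cosh_sub (l x : ℝ) (hx : |x| ≤ 1) :
    Real.exp (-l * x) ≤ Real.cosh l - x * Real.sinh l := by
  obtain ⟨h1, h2⟩ := abs_le.1 hx
  have h := convexOn_exp.2 (Set.mem_univ (-l)) (Set.mem_univ l)
    (show 0 ≤ (1 + x) / 2 by linarith) (show 0 ≤ (1 - x) / 2 by linarith) (by ring)
  simp only [smul_eq_mul] at h
  have e : (1 + x) / 2 * -l + (1 - x) / 2 * l = -l * x := by ring
  rw [e] at h
  rw [Real.cosh_eq, Real.sinh_eq]
  linarith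

lemma azuma_step {Ω : Type*} {m0 : MeasurableSpace Ω}
    {μ : Measure Ω} [IsProbabilityMeasure μ] (m : MeasurableSpace Ω) (hm : m ≤ m0)
    (W X : Ω → ℝ) (hW : StronglyMeasurable[m] W) (hX : StronglyMeasurable[m0] X)
    (hXb : ∀ᵐ ω ∂μ, |X ω| ≤ 1) (C l : ℝ) (hl : 0 ≤ l) (hW0 : ∀ ω, 0 ≤ W ω)
    (hWb : ∀ᵐ ω ∂μ, W ω ≤ C) :
    ∫ ω, W ω * Real.exp (-l * ({ω | 0 ≤ (μ[X|m]) ω}.indicator X ω)) ∂μ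
      ≤ Real.exp (l ^ 2 / 2) * ∫ ω, W ω ∂μ := by
  set G : Set Ω := {ω | 0 ≤ (μ[X|m]) ω} with hG
  have hGm : MeasurableSet[m] G :=
    (stronglyMeasurable_condExp (m := m) (μ := μ) (f := X)).measurable measurableSet_Ici
  have hXi : Integrable X μ := by
    refine Integrable.of_bound hX.aestronglyMeasurable 1 ?_
    simpa using hXb
  have hWi : Integrable W μ := by
    refine Integrable.of_bound (hW.mono hm).aestronglyMeasurable C ?_
    filter_upwards [hWb] with ω h
    rw [Real.norm_eq_abs, abs_of_nonneg (hW0 ω)]; exact h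
  set V : Ω → ℝ := G.indicator W with hV
  have hVm : StronglyMeasurable[m] V := hW.indicator hGm
  have hVX : Integrable (V * X) μ := by
    refine Integrable.of_bound ((hVm.mono hm).mul hX).aestronglyMeasurable C ?_
    filter_upwards [hWb, hXb] with ω h h'
    have h0 := hW0 ω
    have hV1 : |V ω| ≤ C := by
      simp only [hV, Set.indicator]; split_ifs
      · rwa [abs_of_nonneg h0]
      · simp; linarith
    rw [Pi.mul_apply, Real.norm_eq_abs, abs_mul]
    nlinarith [abs_nonneg (V ω), abs_nonneg (X ω)]
  have hpos : 0 ≤ ∫ ω, (V * X) ω ∂μ := by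
    rw [← integral_condExp hm]
    apply integral_nonneg_of_ae
    filter_upwards [condExp_mul_of_stronglyMeasurable_left hVm hVX hXi] with ω h
    rw [h, Pi.mul_apply, Pi.zero_apply]
    simp only [hV, Set.indicator]
    split_ifs with h1
    · exact mul_nonneg (hW0 ω) h1
    · simp
  have hW1 : 0 ≤ ∫ ω, W ω ∂μ := integral_nonneg hW0
  calc _ ≤ ∫ ω, (Real.cosh l * W ω - Real.sinh l * (V * X) ω) ∂μ := by
        apply integral_mono_of_nonneg
        · exact Filter.Eventually.of_forall fun ω => mul_nonneg (hW0 ω) (Real.exp_pos _).le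
        · exact (hWi.const_mul _).sub (hVX.const_mul _)
        · filter_upwards [hXb] with ω h
          have hb : |G.indicator X ω| ≤ 1 := by
            simp only [Set.indicator]; split_ifs
            · exact h
            · simp
          have h2 := mul_le_mul_of_nonneg_left (exp_le_cosh_sub l _ hb) (hW0 ω)
          have e : W ω * G.indicator X ω = V ω * X ω := by
            simp only [hV, Set.indicator]; split_ifs <;> simp
          simp only [Pi.mul_apply]
          rw [← e]
          linarith
    _ = Real.cosh l * ∫ ω, W ω ∂μ - Real.sinh l * ∫ ω, (V * X) ω ∂μ := by
        rw [integral_sub (hWi.const_mul _) (hVX.const_mul _), integral_const_mul,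
          integral_const_mul]
    _ ≤ Real.cosh l * ∫ ω, W ω ∂μ := by
        have := mul_nonneg (Real.sinh_nonneg_iff.2 hl) hpos
        linarith
    _ ≤ _ := mul_le_mul_of_nonneg_right (Real.cosh_le_exp_half_sq l) hW1

/-- for real random variables Y_0,…,Y_n adapted to a filtration
F_0 ⊆ … ⊆ F_n with |Y_{i+1} − Y_i| ≤ 1 a.s., and with D_i the event that
E[Y_i − Y_{i−1} | F_{i−1}] < 0, we have
P[Y_n ≤ Y_0 − ε] ≤ exp(−ε²/(2n)) + P[D_1 ∪ … ∪ D_n] for every ε > 0. -/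
theorem azuma_with_bad_events {Ω : Type*} {m0 : MeasurableSpace Ω}
    {μ : Measure Ω} [IsProbabilityMeasure μ] (n : ℕ)
    (F : Filtration ℕ m0) (Y : ℕ → Ω → ℝ)
    (hadapted : ∀ i ≤ n, StronglyMeasurable[F i] (Y i))
    (hbdd : ∀ i < n, ∀ᵐ ω ∂μ, |Y (i + 1) ω - Y i ω| ≤ 1)
    (ε : ℝ) (hε : 0 < ε) :
    (μ {ω | Y n ω ≤ Y 0 ω - ε}).toReal ≤
      Real.exp (-ε ^ 2 / (2 * n)) +
        (μ (⋃ i ∈ Finset.Icc 1 n, {ω | (μ[Y i - Y (i - 1)|F (i - 1)]) ω < 0})).toReal := by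
  rcases Nat.eq_zero_or_pos n with rfl | hn
  · have : (μ {ω | Y 0 ω ≤ Y 0 ω - ε}).toReal ≤ 1 := measureReal_le_one
    simpa using this
  have hn' : (0 : ℝ) < n := by exact_mod_cast hn
  set l : ℝ := ε / n with hl
  have hl0 : 0 < l := by positivity
  set D := ⋃ i ∈ Finset.Icc 1 n, {ω | (μ[Y i - Y (i - 1)|F (i - 1)]) ω < 0} with hD
  let Z : ℕ → Ω → ℝ := fun i =>
    {ω | 0 ≤ (μ[Y (i + 1) - Y i|F i]) ω}.indicator (Y (i + 1) - Y i)
  let W : ℕ → Ω → ℝ := fun k ω => Real.exp (-l * ∑ i ∈ Finset.range k, Z i ω)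
  have hZm : ∀ i < n, StronglyMeasurable[F (i + 1)] (Z i) := by
    intro i hi
    refine StronglyMeasurable.indicator ((hadapted _ hi).sub
      ((hadapted i hi.le).mono (F.mono (Nat.le_succ i)))) ?_
    refine F.mono (Nat.le_succ i) _ ?_
    exact (stronglyMeasurable_condExp (m := F i) (μ := μ)
      (f := Y (i + 1) - Y i)).measurable measurableSet_Ici
  have hWm : ∀ k ≤ n, StronglyMeasurable[F k] (W k) := by
    intro k hk
    refine Real.continuous_exp.comp_stronglyMeasurable (StronglyMeasurable.const_mul ?_ _)
    refine Finset.stronglyMeasurable_fun_sum _ fun i hi => ?_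
    have hi' := Finset.mem_range.1 hi
    exact (hZm i (by omega)).mono (F.mono hi')
  have hZb : ∀ i < n, ∀ᵐ ω ∂μ, |Z i ω| ≤ 1 := by
    intro i hi
    filter_upwards [hbdd i hi] with ω h
    simp only [Z, Set.indicator]; split_ifs
    · exact h
    · simp
  have hZall : ∀ᵐ ω ∂μ, ∀ i < n, |Z i ω| ≤ 1 := by
    rw [ae_all_iff]; intro i
    by_cases hi : i < n
    · filter_upwards [hZb i hi] with ω h _ using h
    · exact Filter.Eventually.of_forall fun _ h => absurd h hi
  have hWb : ∀ k ≤ n, ∀ᵐ ω ∂μ, W k ω ≤ Real.exp (l * k) := by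
    intro k hk
    filter_upwards [hZall] with ω h
    apply Real.exp_le_exp.2
    have : ∑ i ∈ Finset.range k, (-1 : ℝ) ≤ ∑ i ∈ Finset.range k, Z i ω :=
      Finset.sum_le_sum fun i hi =>
        (abs_le.1 (h i (by have := Finset.mem_range.1 hi; omega))).1
    simp only [Finset.sum_const, Finset.card_range, nsmul_eq_mul] at this
    nlinarith
  have hE : ∀ k ≤ n, ∫ ω, W k ω ∂μ ≤ Real.exp (k * (l ^ 2 / 2)) := by
    intro k
    induction k with
    | zero => intro _; simp [W]
    | succ k ih =>
      intro hk
      have h1 := azuma_step (μ := μ) (F k) (F.le k) (W k) (Y (k + 1) - Y k) (hWm k (by omega))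
        (((hadapted _ hk).mono (F.le _)).sub ((hadapted k (by omega)).mono (F.le _)))
        (hbdd k hk) _ l hl0.le (fun _ => (Real.exp_pos _).le) (hWb k (by omega))
      have e : ∀ ω, W (k + 1) ω = W k ω * Real.exp (-l * Z k ω) := by
        intro ω
        simp only [W]
        rw [← Real.exp_add, Finset.sum_range_succ, mul_add]
      simp_rw [e]
      refine h1.trans ((mul_le_mul_of_nonneg_left (ih (by omega)) (Real.exp_pos _).le).trans ?_)
      rw [← Real.exp_add]
      apply le_of_eq; congr 1; push_cast; ring
  have hWi : Integrable (W n) μ := by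
    refine Integrable.of_bound ((hWm n le_rfl).mono (F.le n)).aestronglyMeasurable
      (Real.exp (l * n)) ?_
    filter_upwards [hWb n le_rfl] with ω h
    rw [Real.norm_eq_abs, abs_of_nonneg (Real.exp_pos _).le]; exact h
  have hmk := mul_meas_ge_le_integral_of_nonneg
    (Filter.Eventually.of_forall fun ω => (Real.exp_pos _).le) hWi (Real.exp (l * ε))
  have hP : μ.real {ω | Real.exp (l * ε) ≤ W n ω} ≤ Real.exp (-ε ^ 2 / (2 * n)) := by
    have h2 := hmk.trans (hE n le_rfl)
    have e : Real.exp (n * (l ^ 2 / 2)) = Real.exp (l * ε) * Real.exp (-ε ^ 2 / (2 * n)) := by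
      rw [← Real.exp_add]; congr 1; rw [hl]; field_simp; ring
    rw [e] at h2
    exact le_of_mul_le_mul_left h2 (Real.exp_pos _)
  have hsub : {ω | Y n ω ≤ Y 0 ω - ε} ⊆ {ω | Real.exp (l * ε) ≤ W n ω} ∪ D := by
    intro ω hω
    by_cases hd : ω ∈ D
    · exact Or.inr hd
    left
    have hz : ∀ i ∈ Finset.range n, Z i ω = Y (i + 1) ω - Y i ω := by
      intro i hi
      have hi' := Finset.mem_range.1 hi
      have : 0 ≤ (μ[Y (i + 1) - Y i|F i]) ω := by
        by_contra hc
        apply hd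
        simp only [hD, Set.mem_iUnion]
        exact ⟨i + 1, Finset.mem_Icc.2 ⟨by omega, by omega⟩, not_le.1 hc⟩
      simp only [Z]
      rw [Set.indicator_of_mem (by exact this)]
      rfl
    simp only [Set.mem_ofPred_eq, W] at hω ⊢
    rw [Finset.sum_congr rfl hz, Finset.sum_range_sub (fun i => Y i ω)]
    apply Real.exp_le_exp.2
    nlinarith
  calc μ.real {ω | Y n ω ≤ Y 0 ω - ε} ≤ μ.real ({ω | Real.exp (l * ε) ≤ W n ω} ∪ D) :=
        measureReal_mono hsub
    _ ≤ _ := measureReal_union_le _ _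
    _ ≤ _ := add_le_add hP le_rfl
end

section
/- Let n ≥ 2 be an integer and let x, y be real numbers with x² ≤ 1/(4n) and |y| ≤ 1/(4n). Then exp(−nx)·exp(−n(|y| + 2x² + 2y²)) ≤ (1 − x + y)^n ≤ exp(−nx)·exp(n(|y| + 2x² + 2y²)), and moreover 1 − 4n(|y| + x²) ≤ (1 − x + y)^n / exp(−nx) ≤ 1 + 4n(|y| + x²). -/
theorem aux_exp_le (t : ℝ) (h1 : -(1/2) ≤ t) (h2 : t ≤ 1/2) :
    Real.exp (t - t ^ 2) ≤ 1 + t := by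
  have key : 1 ≤ (1 + t) * Real.exp (-(t - t ^ 2)) := by
    rcases le_total 0 t with h | h
    · have h3 := Real.add_one_le_exp (-(t - t ^ 2))
      have h4 := mul_le_mul_of_nonneg_left h3 (by linarith : 0 ≤ 1 + t)
      have : 0 ≤ t ^ 3 := by positivity
      nlinarith
    · obtain ⟨a, rfl⟩ : ∃ a, t = -a := ⟨-t, by ring⟩
      have ha : 0 ≤ a := by linarith
      have ha2 : a ≤ 1/2 := by linarith
      have h3 := Real.quadratic_le_exp_of_nonneg (x := -(-a - (-a) ^ 2)) (by nlinarith)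
      have h4 := mul_le_mul_of_nonneg_left h3 (by linarith : 0 ≤ 1 + -a)
      have h5 : a ^ 2 ≤ 1/4 := by nlinarith
      have h6 : a ^ 3 ≤ 1/8 := by nlinarith
      have h7 : 0 ≤ a ^ 2 * (1 - a - a ^ 2 - a ^ 3) := mul_nonneg (by positivity) (by linarith)
      refine le_trans ?_ h4
      nlinarith
  have hp := Real.exp_pos (t - t ^ 2)
  have h := mul_le_mul_of_nonneg_right key hp.le
  rw [mul_assoc, ← Real.exp_add] at h
  simpa using h

/-- for n ≥ 2 and real x, y with x² ≤ 1/(4n) and |y| ≤ 1/(4n), the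
quantity (1−x+y)^n lies between exp(−nx)·exp(∓n(|y|+2x²+2y²)), and the ratio
(1−x+y)^n / exp(−nx) lies between 1 − 4n(|y|+x²) and 1 + 4n(|y|+x²). -/
theorem power_vs_exponential_estimate (n : ℕ) (hn : 2 ≤ n) (x y : ℝ)
    (hx : x ^ 2 ≤ 1 / (4 * n)) (hy : |y| ≤ 1 / (4 * n)) :
    (Real.exp (-n * x) * Real.exp (-n * (|y| + 2 * x ^ 2 + 2 * y ^ 2)) ≤ (1 - x + y) ^ n ∧
      (1 - x + y) ^ n ≤ Real.exp (-n * x) * Real.exp (n * (|y| + 2 * x ^ 2 + 2 * y ^ 2))) ∧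
    (1 - 4 * n * (|y| + x ^ 2) ≤ (1 - x + y) ^ n / Real.exp (-n * x) ∧
      (1 - x + y) ^ n / Real.exp (-n * x) ≤ 1 + 4 * n * (|y| + x ^ 2)) := by
  have hn2 : (2 : ℝ) ≤ n := by exact_mod_cast hn
  have hn0 : (0 : ℝ) < n := by linarith
  have hq : 1 / (4 * (n : ℝ)) ≤ 1 / 8 := by
    apply one_div_le_one_div_of_le <;> linarith
  have hx8 : x ^ 2 ≤ 1 / 8 := hx.trans hq
  have hy8 : |y| ≤ 1 / 8 := hy.trans hq
  have hya := abs_le.mp hy8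
  have hx1 : x ≤ 3 / 8 := by nlinarith
  have hx2 : -(3 / 8) ≤ x := by nlinarith
  have hny : n * |y| ≤ 1 / 4 := by
    have := mul_le_mul_of_nonneg_left hy hn0.le
    have e : (n : ℝ) * (1 / (4 * n)) = 1 / 4 := by field_simp
    linarith
  have hy0 := abs_nonneg y
  have hyl := neg_abs_le y
  have hyu := le_abs_self y
  have hysq : y ^ 2 ≤ |y| / 8 := by
    rw [← sq_abs]; nlinarith
  have hlow : Real.exp (-n * x) * Real.exp (-n * (|y| + 2 * x ^ 2 + 2 * y ^ 2))
      ≤ (1 - x + y) ^ n := by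
    have h := aux_exp_le (-x + y) (by linarith) (by linarith)
    have h' : Real.exp (-x - (|y| + 2 * x ^ 2 + 2 * y ^ 2)) ≤ 1 - x + y := by
      refine le_trans (Real.exp_le_exp.mpr ?_) (h.trans (by linarith))
      nlinarith [sq_nonneg (x + y)]
    have h3 := pow_le_pow_left₀ (Real.exp_pos _).le h' n
    rw [← Real.exp_nat_mul] at h3
    rw [← Real.exp_add]
    exact le_trans (le_of_eq (congrArg Real.exp (by ring))) h3
  have hup : (1 - x + y) ^ n ≤ Real.exp (-n * x) * Real.exp (n * |y|) := by
    have h' : 1 - x + y ≤ Real.exp (-x + |y|) := by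
      have := Real.add_one_le_exp (-x + |y|)
      linarith
    have h3 := pow_le_pow_left₀ (by linarith) h' n
    rw [← Real.exp_nat_mul] at h3
    rw [← Real.exp_add]
    exact le_trans h3 (le_of_eq (congrArg Real.exp (by ring)))
  have hE := Real.exp_pos (-n * x)
  refine ⟨⟨hlow, hup.trans ?_⟩, ?_, ?_⟩
  · gcongr
    nlinarith [sq_nonneg x, sq_nonneg y]
  · rw [le_div_iff₀ hE, mul_comm]
    refine le_trans (mul_le_mul_of_nonneg_left ?_ hE.le) hlow
    have := Real.add_one_le_exp (-n * (|y| + 2 * x ^ 2 + 2 * y ^ 2))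
    have h2 : n * (|y| + 2 * x ^ 2 + 2 * y ^ 2) ≤ n * (4 * (|y| + x ^ 2)) := by
      apply mul_le_mul_of_nonneg_left _ hn0.le
      nlinarith [sq_nonneg x]
    linarith
  · rw [div_le_iff₀ hE, mul_comm]
    refine hup.trans (mul_le_mul_of_nonneg_left ?_ hE.le)
    have hu0 : 0 ≤ n * |y| := by positivity
    have h1 := Real.add_one_le_exp (-(n * |y|))
    have h2 : Real.exp (-(n * |y|)) * Real.exp (n * |y|) = 1 := by
      rw [← Real.exp_add]; simp
    have h3 := Real.exp_pos (n * |y|)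
    have h4 : 0 ≤ n * x ^ 2 := by positivity
    have h5 : Real.exp (n * |y|) ≤ 1 + 4 * (n * |y|) := by
      set u := (n : ℝ) * |y|
      have h6 : (1 - u) * Real.exp u ≤ 1 := by nlinarith
      have h7 : 1 ≤ (1 - u) * (1 + 4 * u) := by nlinarith
      exact le_of_mul_le_mul_left (h6.trans h7) (by linarith)
    linarith
end
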